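/- arXiv:2504.21333 — 3 statements merged into one kernel-verified Lean document; each statement's English description precedes it below -/
import Mathlib

section
/- Let 0 < γ < 1, let α be real, let h, m be positive integers, let q' be a positive integer, and let D ≥ 1, L ≥ 1 be real with L < l and l + q' ≤ 2L for an integer l. Set f(d,t) = αhd²t² − m d^γ t^γ and g(d) = f(d, l+q') − f(d, l). Then for any real D₁, D₂ with D ≤ D₁ ≤ D₂ ≤ 2D, Σ_{D₁ < d ≤ D₂} e(g(d)) ≪ m^{1/6} q'^{1/6} D^{γ/6 + 1/2} L^{γ/6 − 1/6} + m^{−1/3} q'^{−1/3} D^{1 − γ/3} L^{1/3 − γ/3}, where the sum is over integers d in the indicated range and the implied constant depends only on γ. -/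
/-- `e2pi x = e^{2πix}`. -/
noncomputable def e2pi (x : ℝ) : ℂ := Complex.exp (2 * Real.pi * Complex.I * x)

theorem e2pi_add (x y : ℝ) : e2pi (x + y) = e2pi x * e2pi y := by
  simp only [e2pi, ← Complex.exp_add]
  congr 1
  push_cast
  ring

theorem e2pi_int (v : ℤ) : e2pi v = 1 := by
  rw [e2pi, Complex.exp_eq_one_iff]
  exact ⟨v, by push_cast; ring⟩

theorem norm_e2pi (x : ℝ) : ‖e2pi x‖ = 1 := by
  rw [e2pi, show (2 * Real.pi * Complex.I * x : ℂ) = ((2 * Real.pi * x : ℝ) : ℂ) * Complex.I by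
    push_cast; ring]
  exact Complex.norm_exp_ofReal_mul_I _

theorem conj_e2pi (x : ℝ) : (starRingEnd ℂ) (e2pi x) = e2pi (-x) := by
  simp only [e2pi, ← Complex.exp_conj, map_mul, Complex.conj_I, Complex.conj_ofReal, map_ofNat]
  congr 1
  push_cast
  ring

theorem norm_sum_e2pi_neg {ι : Type*} (s : Finset ι) (f : ι → ℝ) :
    ‖∑ i ∈ s, e2pi (-f i)‖ = ‖∑ i ∈ s, e2pi (f i)‖ := by
  simp only [← conj_e2pi, ← map_sum, RCLike.norm_conj]

theorem norm_sum_e2pi_le (N : ℕ) (f : ℕ → ℝ) : ‖∑ n ∈ Finset.range N, e2pi (f n)‖ ≤ N := by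
  refine (norm_sum_le _ _).trans ?_
  simp [norm_e2pi]

/-- `1 / (1 - e(θ))` in terms of the cotangent. -/
theorem one_sub_e2pi_mul (θ : ℝ) (h : Real.sin (Real.pi * θ) ≠ 0) :
    (1 - e2pi θ) * (1 / 2 + Complex.I / 2 *
      ((Real.cos (Real.pi * θ) / Real.sin (Real.pi * θ) : ℝ) : ℂ)) = 1 := by
  have he : e2pi θ = ((Real.cos (Real.pi * θ) : ℂ) + Real.sin (Real.pi * θ) * Complex.I) ^ 2 := by
    rw [Complex.ofReal_cos, Complex.ofReal_sin, ← Complex.exp_mul_I, ← Complex.exp_nat_mul, e2pi]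
    congr 1
    push_cast
    ring
  have hcs : (Real.cos (Real.pi * θ) : ℂ) ^ 2 + (Real.sin (Real.pi * θ) : ℂ) ^ 2 = 1 := by
    exact_mod_cast Real.cos_sq_add_sin_sq (Real.pi * θ)
  have hs : (Real.sin (Real.pi * θ) : ℂ) ≠ 0 := by exact_mod_cast h
  rw [he]
  push_cast only [Complex.ofReal_div]
  generalize (Real.cos (Real.pi * θ) : ℂ) = c at *
  generalize (Real.sin (Real.pi * θ) : ℂ) = s at *
  field_simp
  have hI := Complex.I_sq
  linear_combination (s - Complex.I * c) * hcs - (2 * c ^ 2 * s + s ^ 3 + s ^ 2 * c * Complex.I) * hI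

theorem cot_antitone {a b : ℝ} (ha : 0 < a) (hab : a ≤ b) (hb : b < Real.pi) :
    Real.cos b / Real.sin b ≤ Real.cos a / Real.sin a := by
  have hsa := Real.sin_pos_of_pos_of_lt_pi ha (hab.trans_lt hb)
  have hsb := Real.sin_pos_of_pos_of_lt_pi (ha.trans_le hab) hb
  rw [div_le_div_iff₀ hsb hsa]
  have := Real.sin_nonneg_of_nonneg_of_le_pi (sub_nonneg.2 hab) (by linarith)
  rw [Real.sin_sub] at this
  linarith

theorem two_mul_le_sin {δ θ : ℝ} (hδ : 0 < δ) (h1 : δ ≤ θ) (h2 : θ ≤ 1 - δ) :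
    2 * δ ≤ Real.sin (Real.pi * θ) := by
  have hpi := Real.pi_pos
  have key : ∀ t : ℝ, δ ≤ t → t ≤ 1 / 2 → 2 * δ ≤ Real.sin (Real.pi * t) := by
    intro t h1 h2
    have h := Real.mul_le_sin (x := Real.pi * t) (by nlinarith) (by nlinarith)
    have : 2 / Real.pi * (Real.pi * t) = 2 * t := by field_simp
    linarith
  rcases le_total θ (1 / 2) with h | h
  · exact key θ h1 h
  · have := key (1 - θ) (by linarith) (by linarith)
    rwa [show Real.pi * (1 - θ) = Real.pi - Real.pi * θ by ring, Real.sin_pi_sub] at this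

/-- The Kuzmin–Landau inequality. -/
theorem kuzmin_landau (x : ℕ → ℝ) (N : ℕ) (hmono : Monotone fun n => x (n + 1) - x n)
    (v : ℤ) (δ : ℝ) (hδ : 0 < δ) (hδ' : δ ≤ 1 / 2)
    (h1 : ∀ n, n + 1 < N → v + δ ≤ x (n + 1) - x n)
    (h2 : ∀ n, n + 1 < N → x (n + 1) - x n ≤ v + 1 - δ) :
    ‖∑ n ∈ Finset.range N, e2pi (x n)‖ ≤ 2 / δ := by
  have hone : 2 ≤ 1 / δ := by rw [le_div_iff₀ hδ]; linarith
  have h2δ : 2 / δ = 1 / δ + 1 / δ := by ring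
  rcases Nat.lt_or_ge N 2 with hN | hN
  · refine (norm_sum_e2pi_le N x).trans ?_
    have : (N : ℝ) ≤ 1 := by exact_mod_cast (by omega : N ≤ 1)
    linarith
  obtain ⟨K, rfl⟩ := Nat.exists_eq_add_of_le' hN
  set θ : ℕ → ℝ := fun n => x (n + 1) - x n - v with hθ
  set c : ℕ → ℝ := fun n => Real.cos (Real.pi * θ n) / Real.sin (Real.pi * θ n) with hc
  have hlo : ∀ n ≤ K, δ ≤ θ n := fun n hn => by
    have := h1 n (by omega); simp only [hθ]; linarith
  have hhi : ∀ n ≤ K, θ n ≤ 1 - δ := fun n hn => by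
    have := h2 n (by omega); simp only [hθ]; linarith
  have hsin : ∀ n ≤ K, 2 * δ ≤ Real.sin (Real.pi * θ n) := fun n hn =>
    two_mul_le_sin hδ (hlo n hn) (hhi n hn)
  have hcabs : ∀ n ≤ K, |c n| ≤ 1 / (2 * δ) := fun n hn => by
    have := hsin n hn
    rw [hc, abs_div, abs_of_pos (by linarith : 0 < Real.sin (Real.pi * θ n))]
    exact div_le_div₀ zero_le_one (Real.abs_cos_le_one _) (by linarith) this
  have hcanti : ∀ n < K, c (n + 1) ≤ c n := fun n hn => by
    have hpi := Real.pi_pos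
    refine cot_antitone (mul_pos hpi (by linarith [hlo n hn.le])) ?_ ?_
    · refine mul_le_mul_of_nonneg_left ?_ hpi.le
      have := hmono (Nat.le_succ n)
      simp only [hθ]
      simpa using this
    · have := hhi (n + 1) hn
      nlinarith
  set w : ℕ → ℂ := fun n => 1 / 2 + Complex.I / 2 * (c n : ℂ) with hw
  have hwnorm : ∀ n ≤ K, ‖w n‖ ≤ 1 / 2 + 1 / (4 * δ) := fun n hn => by
    refine (norm_add_le _ _).trans ?_
    have := hcabs n hn
    simp only [norm_mul, norm_div, Complex.norm_I, Complex.norm_real, Real.norm_eq_abs, norm_one,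
      RCLike.norm_ofNat]
    have h4 : 1 / (4 * δ) = 1 / 2 * (1 / (2 * δ)) := by ring
    rw [h4]
    linarith
  have hz : ∀ n ≤ K, (e2pi (x n) - e2pi (x (n + 1))) * w n = e2pi (x n) := fun n hn => by
    have h3 := one_sub_e2pi_mul (θ n) (by linarith [hsin n hn])
    have h4 : e2pi (x (n + 1)) = e2pi (x n) * e2pi (θ n) := by
      rw [← mul_one (e2pi (x n) * _), ← e2pi_int v, ← e2pi_add, ← e2pi_add]
      congr 1
      simp only [hθ]
      ring
    rw [h4]
    calc _ = e2pi (x n) * ((1 - e2pi (θ n)) * w n) := by ring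
      _ = _ := by rw [hw]; simp only [hc]; rw [h3, mul_one]
  have key : ∀ k ≤ K, ‖∑ n ∈ Finset.range (k + 1), e2pi (x n) + e2pi (x (k + 1)) * w k‖
      ≤ 1 / 2 + 1 / (4 * δ) + (c 0 - c k) / 2 := by
    intro k
    induction k with
    | zero =>
      intro _
      have := hz 0 (Nat.zero_le _)
      simp only [zero_add, Finset.sum_range_one, sub_self, zero_div, add_zero]
      rw [show e2pi (x 0) + e2pi (x 1) * w 0 = e2pi (x 0) * w 0 by
        rw [zero_add] at this; linear_combination -this]
      rw [norm_mul, norm_e2pi, one_mul]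
      exact hwnorm 0 (Nat.zero_le _)
    | succ k ih =>
      intro hk
      have h3 := hz (k + 1) hk
      rw [Finset.sum_range_succ]
      rw [show ∑ n ∈ Finset.range (k + 1), e2pi (x n) + e2pi (x (k + 1)) +
          e2pi (x (k + 1 + 1)) * w (k + 1) =
          (∑ n ∈ Finset.range (k + 1), e2pi (x n) + e2pi (x (k + 1)) * w k) +
          e2pi (x (k + 1)) * (w (k + 1) - w k) by linear_combination -h3]
      refine (norm_add_le _ _).trans ?_
      have h5 : ‖e2pi (x (k + 1)) * (w (k + 1) - w k)‖ = (c k - c (k + 1)) / 2 := by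
        rw [norm_mul, norm_e2pi, one_mul]
        rw [show w (k + 1) - w k = Complex.I / 2 * ((c (k + 1) - c k : ℝ) : ℂ) by
          simp only [hw]; push_cast; ring]
        rw [norm_mul, norm_div, Complex.norm_I, Complex.norm_real, Real.norm_eq_abs,
          abs_of_nonpos (by linarith [hcanti k hk]), RCLike.norm_ofNat]
        ring
      rw [h5]
      linarith [ih (by omega)]
  have hK := key K le_rfl
  rw [Finset.sum_range_succ]
  rw [show ∑ n ∈ Finset.range (K + 1), e2pi (x n) + e2pi (x (K + 1)) =
    (∑ n ∈ Finset.range (K + 1), e2pi (x n) + e2pi (x (K + 1)) * w K) +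
      (e2pi (x (K + 1)) - e2pi (x (K + 1)) * w K) by ring]
  have h6 : ‖e2pi (x (K + 1)) - e2pi (x (K + 1)) * w K‖ ≤ 1 + (1 / 2 + 1 / (4 * δ)) := by
    refine (norm_sub_le _ _).trans ?_
    rw [norm_mul, norm_e2pi, one_mul]
    linarith [hwnorm K le_rfl]
  have h7 := (abs_le.1 (hcabs 0 (Nat.zero_le _))).2
  have h8 := (abs_le.1 (hcabs K le_rfl)).1
  have h9 : 1 / (4 * δ) = (1 / δ) / 4 := by ring
  have h10 : 1 / (2 * δ) = (1 / δ) / 2 := by ring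
  rw [h9] at hK h6
  rw [h10] at h7 h8
  refine (norm_add_le _ _).trans ?_
  linarith

theorem norm_sq_sum_shift_corr_le (z : ℕ → ℂ) (N H : ℕ) (g : ℕ → ℝ)
    (hg : ∀ h, ‖∑ n ∈ Finset.range (N - h), z (n + h) * (starRingEnd ℂ) (z n)‖ ≤ g h) :
    (H : ℝ) ^ 2 * ‖∑ n ∈ Finset.range N, z n‖ ^ 2 ≤
      (N + H) * (H * (g 0 + 2 * ∑ h ∈ Finset.Ico 1 H, g h)) := by
  have hg0 : ∀ h, 0 ≤ g h := fun h => (norm_nonneg _).trans (hg h)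
  set P : ℕ → ℕ → ℂ := fun m k => if k ≤ m ∧ m - k < N then z (m - k) else 0 with hP
  have hsum : ∀ k < H, ∑ m ∈ Finset.range (N + H), P m k = ∑ n ∈ Finset.range N, z n := by
    intro k hk
    simp only [hP]
    rw [← Finset.sum_filter]
    refine Finset.sum_nbij' (fun m => m - k) (fun n => n + k) ?_ ?_ ?_ ?_ ?_
    all_goals intro a ha
    all_goals simp only [Finset.mem_filter, Finset.mem_range] at *
    all_goals omega
  have hcorr1 : ∀ k h, k + h < H → ‖∑ m ∈ Finset.range (N + H),
      P m k * (starRingEnd ℂ) (P m (k + h))‖ ≤ g h := by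
    intro k h hk
    refine le_of_eq_of_le (congrArg norm ?_) (hg h)
    have : ∀ m, P m k * (starRingEnd ℂ) (P m (k + h)) =
        if k + h ≤ m ∧ m - k < N then z (m - k) * (starRingEnd ℂ) (z (m - (k + h))) else 0 := by
      intro m
      simp only [hP]
      by_cases h1 : k + h ≤ m ∧ m - k < N
      · rw [if_pos h1, if_pos ⟨by omega, h1.2⟩, if_pos ⟨h1.1, by omega⟩]
      · rw [if_neg h1]
        by_cases h2 : k ≤ m ∧ m - k < N
        · rw [if_neg (show ¬ (k + h ≤ m ∧ m - (k + h) < N) by omega), map_zero, mul_zero]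
        · rw [if_neg h2, zero_mul]
    simp only [this]
    rw [← Finset.sum_filter]
    refine Finset.sum_nbij' (fun m => m - (k + h)) (fun n => n + (k + h)) ?_ ?_ ?_ ?_ ?_
    all_goals intro a ha
    all_goals simp only [Finset.mem_filter, Finset.mem_range] at *
    · omega
    · constructor <;> omega
    · omega
    · omega
    · rw [show a - k = a - (k + h) + h by omega]
  have hcorr : ∀ k < H, ∀ k' < H, ‖∑ m ∈ Finset.range (N + H),
      P m k * (starRingEnd ℂ) (P m k')‖ ≤ g (k' - k + (k - k')) := by
    intro k hk k' hk'
    rcases le_total k k' with h | h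
    · obtain ⟨j, rfl⟩ := Nat.exists_eq_add_of_le h
      rw [show k + j - k + (k - (k + j)) = j by omega]
      exact hcorr1 k j hk'
    · obtain ⟨j, rfl⟩ := Nat.exists_eq_add_of_le h
      rw [show k' - (k' + j) + (k' + j - k') = j by omega]
      refine le_of_eq_of_le ?_ (hcorr1 k' j hk)
      rw [← RCLike.norm_conj]
      simp [map_sum, mul_comm]
  have hrow : ∀ k < H, ∑ k' ∈ Finset.range H, g (k' - k + (k - k')) ≤
      g 0 + 2 * ∑ h ∈ Finset.Ico 1 H, g h := by
    intro k hk
    have e1 : ∑ k' ∈ Finset.Ico (k + 1) H, g (k' - k + (k - k')) ≤ ∑ h ∈ Finset.Ico 1 H, g h := by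
      rw [show ∑ k' ∈ Finset.Ico (k + 1) H, g (k' - k + (k - k')) = ∑ h ∈ Finset.Ico 1 (H - k), g h by
        refine Finset.sum_nbij' (fun m => m - k) (fun n => n + k) ?_ ?_ ?_ ?_ ?_
        all_goals intro a ha
        all_goals simp only [Finset.mem_Ico] at *
        · omega
        · omega
        · omega
        · omega
        · congr 1; omega]
      exact Finset.sum_le_sum_of_subset_of_nonneg (Finset.Ico_subset_Ico le_rfl (by omega))
        fun _ _ _ => hg0 _
    have e2 : ∑ k' ∈ Finset.range k, g (k' - k + (k - k')) ≤ ∑ h ∈ Finset.Ico 1 H, g h := by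
      rw [show ∑ k' ∈ Finset.range k, g (k' - k + (k - k')) = ∑ h ∈ Finset.Ico 1 (k + 1), g h by
        refine Finset.sum_nbij' (fun m => k - m) (fun n => k - n) ?_ ?_ ?_ ?_ ?_
        all_goals intro a ha
        all_goals simp only [Finset.mem_Ico, Finset.mem_range] at *
        · omega
        · omega
        · omega
        · omega
        · congr 1; omega]
      exact Finset.sum_le_sum_of_subset_of_nonneg (Finset.Ico_subset_Ico le_rfl (by omega))
        fun _ _ _ => hg0 _
    rw [← Finset.sum_range_add_sum_Ico _ hk, Finset.sum_range_succ]
    simp only [Nat.sub_self, add_zero]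
    linarith
  have hHS : (H : ℂ) * ∑ n ∈ Finset.range N, z n =
      ∑ m ∈ Finset.range (N + H), ∑ k ∈ Finset.range H, P m k := by
    rw [Finset.sum_comm, Finset.sum_congr rfl fun k hk => hsum k (Finset.mem_range.1 hk)]
    simp
  have hsq : (((∑ m ∈ Finset.range (N + H), ‖∑ k ∈ Finset.range H, P m k‖ ^ 2 : ℝ)) : ℂ) =
      ∑ k ∈ Finset.range H, ∑ k' ∈ Finset.range H, ∑ m ∈ Finset.range (N + H),
        P m k * (starRingEnd ℂ) (P m k') := by
    rw [Finset.sum_congr rfl fun k _ => Finset.sum_comm, Finset.sum_comm]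
    push_cast
    refine Finset.sum_congr rfl fun m _ => ?_
    rw [← Complex.mul_conj', map_sum, Finset.sum_mul_sum]
  have hle : ∑ m ∈ Finset.range (N + H), ‖∑ k ∈ Finset.range H, P m k‖ ^ 2 ≤
      H * (g 0 + 2 * ∑ h ∈ Finset.Ico 1 H, g h) := by
    have h0 : 0 ≤ ∑ m ∈ Finset.range (N + H), ‖∑ k ∈ Finset.range H, P m k‖ ^ 2 :=
      Finset.sum_nonneg fun _ _ => sq_nonneg _
    rw [← abs_of_nonneg h0, ← Real.norm_eq_abs, ← Complex.norm_real, hsq]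
    refine (norm_sum_le _ _).trans ?_
    calc _ ≤ ∑ k ∈ Finset.range H, (g 0 + 2 * ∑ h ∈ Finset.Ico 1 H, g h) := by
          refine Finset.sum_le_sum fun k hk => ?_
          refine (norm_sum_le _ _).trans (le_trans ?_ (hrow k (Finset.mem_range.1 hk)))
          exact Finset.sum_le_sum fun k' hk' =>
            hcorr k (Finset.mem_range.1 hk) k' (Finset.mem_range.1 hk')
      _ = _ := by rw [Finset.sum_const, Finset.card_range, nsmul_eq_mul]
  calc (H : ℝ) ^ 2 * ‖∑ n ∈ Finset.range N, z n‖ ^ 2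
      = ‖∑ m ∈ Finset.range (N + H), ∑ k ∈ Finset.range H, P m k‖ ^ 2 := by
        rw [← hHS, norm_mul, mul_pow]; simp
    _ ≤ (∑ m ∈ Finset.range (N + H), ‖∑ k ∈ Finset.range H, P m k‖) ^ 2 := by
        gcongr; exact norm_sum_le _ _
    _ ≤ (N + H : ℝ) * ∑ m ∈ Finset.range (N + H), ‖∑ k ∈ Finset.range H, P m k‖ ^ 2 := by
        have := sq_sum_le_card_mul_sum_sq (s := Finset.range (N + H))
          (f := fun m => ‖∑ k ∈ Finset.range H, P m k‖)
        simpa using this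
    _ ≤ _ := by gcongr

/-- The van der Corput inequality for exponential sums. -/
theorem van_der_corput (f : ℕ → ℝ) (N H : ℕ) (hH : 1 ≤ H) (hHN : H ≤ N) :
    ‖∑ n ∈ Finset.range N, e2pi (f n)‖ ^ 2 ≤ 2 * N / H *
      (N + 2 * ∑ h ∈ Finset.Ico 1 H, ‖∑ n ∈ Finset.range (N - h), e2pi (f (n + h) - f n)‖) := by
  have h := norm_sq_sum_shift_corr_le (fun n => e2pi (f n)) N H
    (fun h => ‖∑ n ∈ Finset.range (N - h), e2pi (f (n + h) - f n)‖) (fun h => by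
      refine le_of_eq (congrArg norm (Finset.sum_congr rfl fun n _ => ?_))
      rw [conj_e2pi, ← e2pi_add, sub_eq_add_neg])
  have h0 : ‖∑ n ∈ Finset.range (N - 0), e2pi (f (n + 0) - f n)‖ ≤ N :=
    norm_sum_e2pi_le N fun n => f (n + 0) - f n
  set A := ∑ h ∈ Finset.Ico 1 H, ‖∑ n ∈ Finset.range (N - h), e2pi (f (n + h) - f n)‖
  have hA : 0 ≤ A := Finset.sum_nonneg fun _ _ => norm_nonneg _
  have hH' : (1 : ℝ) ≤ H := by exact_mod_cast hH
  have hHN' : (H : ℝ) ≤ N := by exact_mod_cast hHN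
  rw [div_mul_eq_mul_div, le_div_iff₀ (by linarith)]
  refine le_of_mul_le_mul_left ?_ (by linarith : (0 : ℝ) < H)
  calc _ = (H : ℝ) ^ 2 * ‖∑ n ∈ Finset.range N, e2pi (f n)‖ ^ 2 := by ring
    _ ≤ _ := h
    _ ≤ (N + N) * (H * (N + 2 * A)) := by gcongr
    _ = _ := by ring

theorem exists_threshold (θ : ℕ → ℝ) (hθ : Monotone θ) (c : ℝ) (N : ℕ) :
    ∃ k ≤ N, (∀ n < k, θ n < c) ∧ ∀ n, k ≤ n → n < N → c ≤ θ n := by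
  induction N with
  | zero => exact ⟨0, le_rfl, by simp, by simp⟩
  | succ N ih =>
    obtain ⟨k, hk, h1, h2⟩ := ih
    by_cases h : θ N < c
    · exact ⟨N + 1, le_rfl, fun n hn => (hθ (Nat.lt_succ_iff.1 hn)).trans_lt h, by omega⟩
    · refine ⟨k, by omega, h1, fun n hn hn' => ?_⟩
      rcases Nat.lt_succ_iff_lt_or_eq.1 hn' with h3 | rfl
      · exact h2 n hn h3
      · exact not_lt.1 h

theorem sum_range_split {E : Type*} [AddCommMonoid E] (F : ℕ → E) {k N : ℕ} (h : k ≤ N) :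
    ∑ n ∈ Finset.range N, F n =
      ∑ n ∈ Finset.range k, F n + ∑ n ∈ Finset.range (N - k), F (k + n) := by
  rw [← Finset.sum_range_add_sum_Ico _ h, Finset.sum_Ico_eq_sum_range]

/-- A discrete second derivative test, for first differences in a short interval. -/
theorem second_difference_test (x : ℕ → ℝ) (N : ℕ) (μ α : ℝ) (hμ : 0 < μ) (hμ' : μ ≤ 1 / 9)
    (hd : ∀ n, μ ≤ (x (n + 2) - x (n + 1)) - (x (n + 1) - x n))
    (h1 : ∀ n, n + 1 < N → α ≤ x (n + 1) - x n)
    (h2 : ∀ n, n + 1 < N → x (n + 1) - x n ≤ α + 1 / 4) :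
    ‖∑ n ∈ Finset.range N, e2pi (x n)‖ ≤ 8 / √μ := by
  set θ : ℕ → ℝ := fun n => x (n + 1) - x n with hθ
  have hmono : Monotone θ := monotone_nat_of_le_succ fun n => by
    have := hd n; simp only [hθ]; linarith
  have hgrow : ∀ k n, θ k + n * μ ≤ θ (k + n) := by
    intro k n
    induction n with
    | zero => simp
    | succ n ih =>
      have := hd (k + n)
      have e : θ (k + (n + 1)) - θ (k + n) = (x (k + n + 2) - x (k + n + 1)) -
        (x (k + n + 1) - x (k + n)) := rfl
      push_cast
      linarith
  obtain ⟨δ, hδ⟩ : ∃ δ, δ = √μ := ⟨_, rfl⟩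
  have hδpos : 0 < δ := hδ ▸ Real.sqrt_pos.2 hμ
  have hδsq : δ * δ = μ := hδ ▸ Real.mul_self_sqrt hμ.le
  have hδle : δ ≤ 1 / 3 := by nlinarith
  rw [← hδ]
  obtain ⟨v, hv⟩ : ∃ v : ℤ, |α + 1 / 8 - v| ≤ 1 / 2 := ⟨round (α + 1 / 8), abs_sub_round _⟩
  rw [abs_le] at hv
  obtain ⟨k, hkN, hk1, hk2⟩ := exists_threshold θ hmono (v - δ) N
  obtain ⟨j, hjN, hj1, hj2⟩ := exists_threshold θ hmono (v + δ) N
  have hkj : k ≤ j := by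
    by_contra hlt
    push Not at hlt
    have := hk1 j hlt
    have := hj2 j le_rfl (by omega)
    linarith
  have hone : 3 ≤ 1 / δ := by rw [le_div_iff₀ hδpos]; linarith
  rw [sum_range_split _ hjN, sum_range_split _ hkj]
  have b1 : ‖∑ n ∈ Finset.range k, e2pi (x n)‖ ≤ 2 / δ := by
    refine kuzmin_landau x k hmono (v - 1) δ hδpos (by linarith) ?_ ?_
    · intro n hn
      have := h1 n (by omega)
      push_cast
      linarith
    · intro n hn
      have := hk1 n (by omega)
      simp only [hθ] at this
      push_cast
      linarith
  have b3 : ‖∑ n ∈ Finset.range (N - j), e2pi (x (j + n))‖ ≤ 2 / δ := by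
    refine kuzmin_landau (fun n => x (j + n)) (N - j) (fun a b hab => hmono (by omega : j + a ≤ j + b))
      v δ hδpos (by linarith) ?_ ?_
    · intro n hn
      have := hj2 (j + n) (by omega) (by omega)
      simpa [hθ, add_assoc] using this
    · intro n hn
      have := h2 (j + n) (by omega)
      simp only [← add_assoc]
      linarith
  have b2 : ‖∑ n ∈ Finset.range (j - k), e2pi (x (k + n))‖ ≤ 3 / δ := by
    refine (norm_sum_e2pi_le (j - k) fun n => x (k + n)).trans ?_
    rcases Nat.eq_or_lt_of_le hkj with h | h
    · rw [h, Nat.sub_self, Nat.cast_zero]; positivity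
    have e1 := hj1 (j - 1) (by omega)
    have e2 := hk2 k le_rfl (by omega)
    have e3 := hgrow k (j - k - 1)
    rw [show k + (j - k - 1) = j - 1 by omega] at e3
    have e4 : ((j - k : ℕ) : ℝ) = ((j - k - 1 : ℕ) : ℝ) + 1 := by
      rw [show j - k = j - k - 1 + 1 by omega]; push_cast; simp
    have e5 : ((j - k - 1 : ℕ) : ℝ) * δ ≤ 2 := by
      refine le_of_mul_le_mul_right (a := δ) ?_ hδpos
      rw [mul_assoc, hδsq]
      linarith
    rw [e4, le_div_iff₀ hδpos]
    linarith
  calc _ ≤ (2 / δ + 3 / δ) + 2 / δ := by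
        refine (norm_add_le _ _).trans (add_le_add ((norm_add_le _ _).trans (add_le_add b1 b2)) b3)
    _ ≤ 8 / δ := by rw [← add_div, ← add_div]; gcongr; norm_num

/-- Distance to the nearest integer. -/
noncomputable def distInt (x : ℝ) : ℝ := |x - round x|

theorem distInt_eq (x : ℝ) : distInt x = min (Int.fract x) (1 - Int.fract x) :=
  abs_sub_round_eq_min x

theorem distInt_add_int (x : ℝ) (v : ℤ) : distInt (x + v) = distInt x := by
  rw [distInt_eq, distInt_eq, Int.fract_add_intCast]

theorem distInt_natCast_div {r q : ℕ} (h : r < q) :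
    distInt ((r : ℝ) / q) = min ((r : ℝ) / q) (1 - (r : ℝ) / q) := by
  have hq : (0 : ℝ) < q := by exact_mod_cast (Nat.zero_le r).trans_lt h
  have hr : (r : ℝ) < q := by exact_mod_cast h
  rw [distInt_eq, Int.fract_eq_self.2 ⟨by positivity, (div_lt_one hq).2 hr⟩]

theorem kuzmin_landau_distInt (x : ℕ → ℝ) (N : ℕ) (hmono : Monotone fun n => x (n + 1) - x n)
    (ξ ε : ℝ) (hε : 2 * ε ≤ distInt ξ) (hpos : 0 < distInt ξ)
    (h : ∀ n, n + 1 < N → |x (n + 1) - x n - ξ| ≤ ε) :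
    ‖∑ n ∈ Finset.range N, e2pi (x n)‖ ≤ 4 / distInt ξ := by
  have h1 : distInt ξ ≤ Int.fract ξ := (distInt_eq ξ).le.trans (min_le_left _ _)
  have h2 : distInt ξ ≤ 1 - Int.fract ξ := (distInt_eq ξ).le.trans (min_le_right _ _)
  have h3 := Int.floor_add_fract ξ
  rw [show 4 / distInt ξ = 2 / (distInt ξ / 2) by ring]
  refine kuzmin_landau x N hmono ⌊ξ⌋ _ (by linarith) (by linarith) ?_ ?_
  · intro n hn
    have := (abs_le.1 (h n hn)).1
    linarith
  · intro n hn
    have := (abs_le.1 (h n hn)).2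
    linarith

theorem sum_inv_sqrt_le (n : ℕ) : ∑ k ∈ Finset.range n, 1 / √((k : ℝ) + 1) ≤ 2 * √n := by
  induction n with
  | zero => simp
  | succ n ih =>
    rw [Finset.sum_range_succ]
    push_cast
    have ha := Real.sqrt_nonneg (n : ℝ)
    have hb : 0 < √((n : ℝ) + 1) := Real.sqrt_pos.2 (by positivity)
    have ha2 := Real.mul_self_sqrt (Nat.cast_nonneg (α := ℝ) n)
    have hb2 := Real.mul_self_sqrt (by positivity : 0 ≤ (n : ℝ) + 1)
    generalize √(n : ℝ) = a at *
    generalize √((n : ℝ) + 1) = b at *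
    have : 1 / b ≤ 2 * b - 2 * a := by
      rw [div_le_iff₀ hb]
      nlinarith [sq_nonneg (a - b)]
    linarith

theorem sum_inv_le (n : ℕ) : ∑ k ∈ Finset.range n, 1 / ((k : ℝ) + 1) ≤ 2 * √n := by
  refine le_trans (Finset.sum_le_sum fun k _ => ?_) (sum_inv_sqrt_le n)
  have h : (1 : ℝ) ≤ (k : ℝ) + 1 := by linarith [Nat.cast_nonneg (α := ℝ) k]
  have h2 : √((k : ℝ) + 1) ≤ (k : ℝ) + 1 :=
    Real.sqrt_le_iff.2 ⟨by linarith, by nlinarith⟩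
  exact one_div_le_one_div_of_le (Real.sqrt_pos.2 (by linarith)) h2

theorem sum_inv_pow_three_fourths_le (n : ℕ) :
    ∑ k ∈ Finset.range n, 1 / (√√((k : ℝ) + 1)) ^ 3 ≤ 4 * √√n := by
  induction n with
  | zero => simp
  | succ n ih =>
    rw [Finset.sum_range_succ]
    push_cast
    have ha := Real.sqrt_nonneg √(n : ℝ)
    have hb : 0 < √√((n : ℝ) + 1) := Real.sqrt_pos.2 (Real.sqrt_pos.2 (by positivity))
    have ha4 : √√(n : ℝ) ^ 4 = n := by
      rw [show 4 = 2 * 2 from rfl, pow_mul, Real.sq_sqrt (Real.sqrt_nonneg _),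
        Real.sq_sqrt (Nat.cast_nonneg _)]
    have hb4 : √√((n : ℝ) + 1) ^ 4 = n + 1 := by
      rw [show 4 = 2 * 2 from rfl, pow_mul, Real.sq_sqrt (Real.sqrt_nonneg _),
        Real.sq_sqrt (by positivity)]
    generalize √√(n : ℝ) = a at *
    generalize √√((n : ℝ) + 1) = b at *
    have : 1 / b ^ 3 ≤ 4 * b - 4 * a := by
      rw [div_le_iff₀ (by positivity)]
      nlinarith [mul_nonneg (sq_nonneg (a - b)) (by positivity : 0 ≤ a ^ 2 + 2 * a * b + 3 * b ^ 2)]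
    linarith

theorem sum_min_div_le (n : ℕ) (a b : ℝ) (ha : 0 ≤ a) (hb : 0 ≤ b) :
    ∑ k ∈ Finset.range n, min a (b / ((k : ℝ) + 1)) ≤ 4 * (√√a * (√√b) ^ 3 * √√n) := by
  have hmin : ∀ u v : ℝ, 0 ≤ u → 0 ≤ v → min (u ^ 4) (v ^ 4) ≤ u * v ^ 3 := by
    intro u v hu hv
    rcases le_total u v with h | h
    · refine (min_le_left _ _).trans ?_
      calc u ^ 4 = u * u ^ 3 := by ring
        _ ≤ u * v ^ 3 := by gcongr
    · refine (min_le_right _ _).trans ?_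
      calc v ^ 4 = v * v ^ 3 := by ring
        _ ≤ u * v ^ 3 := by gcongr
  have h4 : ∀ t : ℝ, 0 ≤ t → √√t ^ 4 = t := fun t ht => by
    rw [show 4 = 2 * 2 from rfl, pow_mul, Real.sq_sqrt (Real.sqrt_nonneg _), Real.sq_sqrt ht]
  calc _ ≤ ∑ k ∈ Finset.range n, √√a * (√√b) ^ 3 * (1 / (√√((k : ℝ) + 1)) ^ 3) := by
        refine Finset.sum_le_sum fun k _ => ?_
        have hk : (0 : ℝ) < (k : ℝ) + 1 := by positivity
        have := hmin √√a √√(b / ((k : ℝ) + 1)) (Real.sqrt_nonneg _) (Real.sqrt_nonneg _)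
        rw [h4 a ha, h4 _ (by positivity)] at this
        refine this.trans (le_of_eq ?_)
        rw [Real.sqrt_div' _ hk.le, Real.sqrt_div' _ (Real.sqrt_nonneg _), div_pow]
        ring
    _ ≤ √√a * (√√b) ^ 3 * (4 * √√n) := by
        rw [← Finset.mul_sum]
        exact mul_le_mul_of_nonneg_left (sum_inv_pow_three_fourths_le n) (by positivity)
    _ = _ := by ring

theorem sum_range_zmod {q : ℕ} [NeZero q] (G : ZMod q → ℝ) :
    ∑ h ∈ Finset.range q, G h = ∑ x, G x := by
  refine Finset.sum_nbij' (fun h => (h : ZMod q)) ZMod.val ?_ ?_ ?_ ?_ ?_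
  · simp
  · intro a _
    exact Finset.mem_range.2 (ZMod.val_lt a)
  · intro a ha
    exact ZMod.val_cast_of_lt (Finset.mem_range.1 ha)
  · intro a _
    exact ZMod.natCast_zmod_val a
  · simp

theorem sum_range_mul_unit_le {q : ℕ} [NeZero q] (G : ZMod q → ℝ) (hG : ∀ x, 0 ≤ G x)
    (u : (ZMod q)ˣ) (T : ℕ) :
    ∑ h ∈ Finset.range T, G ((h : ZMod q) * u) ≤ ((T : ℝ) / q + 1) * ∑ x, G x := by
  have hblock : ∀ k, ∑ h ∈ Finset.range (q * k), G ((h : ZMod q) * u) = k * ∑ x, G x := by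
    intro k
    induction k with
    | zero => simp
    | succ k ih =>
      rw [Nat.mul_succ, Finset.sum_range_add, ih]
      have : ∀ h : ℕ, ((q * k + h : ℕ) : ZMod q) = h := by intro h; simp
      simp only [this]
      have e : ∑ x, G (x * u) = ∑ x, G x := Equiv.sum_comp (Units.mulRight u) G
      rw [sum_range_zmod (fun x : ZMod q => G (x * u)), e]
      push_cast
      ring
  have hq : (0 : ℝ) < q := by exact_mod_cast Nat.pos_of_ne_zero (NeZero.ne q)
  have hle : T ≤ q * (T / q + 1) := by
    have := Nat.lt_mul_div_succ T (Nat.pos_of_ne_zero (NeZero.ne q))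
    exact this.le
  calc _ ≤ ∑ h ∈ Finset.range (q * (T / q + 1)), G ((h : ZMod q) * u) :=
        Finset.sum_le_sum_of_subset_of_nonneg (Finset.range_mono hle) fun _ _ _ => hG _
    _ = ((T / q : ℕ) + 1 : ℝ) * ∑ x, G x := by rw [hblock]; push_cast; ring
    _ ≤ _ := by
        refine mul_le_mul_of_nonneg_right ?_ (Finset.sum_nonneg fun x _ => hG x)
        gcongr
        exact Nat.cast_div_le

theorem sum_distInt_le (φ : ℝ → ℝ) (hφ : ∀ x, 0 ≤ φ x) {q : ℕ} (hq : 0 < q) (A : ℤ)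
    (hA : IsCoprime A (q : ℤ)) (T : ℕ) :
    ∑ h ∈ Finset.range T, φ (distInt (h * (A / q))) ≤
      ((T : ℝ) / q + 1) * ∑ r ∈ Finset.range q, φ (distInt ((r : ℝ) / q)) := by
  have : NeZero q := ⟨hq.ne'⟩
  have hq' : (q : ℝ) ≠ 0 := by exact_mod_cast hq.ne'
  obtain ⟨u, hu⟩ : IsUnit (A : ZMod q) := (ZMod.coe_int_isUnit_iff_isCoprime A q).2 hA.symm
  set G : ZMod q → ℝ := fun x => φ (distInt ((x.val : ℝ) / q)) with hG
  have e1 : ∀ h : ℕ, φ (distInt (h * (A / q))) = G (h * u) := by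
    intro h
    simp only [hG, hu]
    have h1 : (((h * A : ZMod q).val : ℕ) : ℤ) = (h * A) % q := by
      have := ZMod.val_intCast (n := q) (h * A : ℤ)
      push_cast at this
      exact this
    have h2 : (((h * A : ZMod q).val : ℕ) : ℝ) = (((h * A) % q : ℤ) : ℝ) := by
      rw [← h1]; simp
    have h3 : (h : ℝ) * (A / q) = (((h * A) % q : ℤ) : ℝ) / q + ((h * A / q : ℤ) : ℝ) := by
      have h4 := Int.emod_add_mul_ediv ((h : ℤ) * A) q
      have h5 : (((h : ℤ) * A : ℤ) : ℝ) = (((h * A) % q + q * (h * A / q) : ℤ) : ℝ) := by rw [h4]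
      rw [Int.cast_add, Int.cast_mul, Int.cast_mul] at h5
      simp only [Int.cast_natCast] at h5
      rw [← mul_div_assoc, h5]
      field_simp
    rw [h2, h3, distInt_add_int]
  rw [Finset.sum_congr rfl fun h _ => e1 h]
  refine (sum_range_mul_unit_le G (fun _ => hφ _) u T).trans (le_of_eq ?_)
  rw [← sum_range_zmod G]
  congr 1
  refine Finset.sum_congr rfl fun r hr => ?_
  simp only [hG]
  rw [ZMod.val_cast_of_lt (Finset.mem_range.1 hr)]

theorem sum_inv_distInt_le (q : ℕ) :
    ∑ r ∈ Finset.range q, 1 / distInt ((r : ℝ) / q) ≤ 4 * q * √q := by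
  have h1 : ∀ r ∈ Finset.range q, 1 / distInt ((r : ℝ) / q) ≤ q * (1 / (r : ℝ)) +
      q * (1 / (((q - 1 - r : ℕ) : ℝ) + 1)) := by
    intro r hr
    have hr := Finset.mem_range.1 hr
    have hrq : (r : ℝ) < q := by exact_mod_cast hr
    have hq : (0 : ℝ) < q := by exact_mod_cast (Nat.zero_le r).trans_lt hr
    have e : ((q - 1 - r : ℕ) : ℝ) + 1 = q - r := by
      rw [Nat.sub_sub, Nat.cast_sub (by omega)]; push_cast; ring
    rw [e, distInt_natCast_div hr]
    rcases Nat.eq_zero_or_pos r with rfl | h0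
    · simp; positivity
    have h0 : (0 : ℝ) < r := by exact_mod_cast h0
    have h3 : 0 < (q : ℝ) - r := by linarith
    rcases min_choice ((r : ℝ) / q) (1 - (r : ℝ) / q) with h | h <;> rw [h]
    · rw [one_div_div, mul_one_div]
      have : 0 ≤ (q : ℝ) * (1 / (q - r)) := by positivity
      linarith
    · rw [one_sub_div hq.ne', one_div_div, mul_one_div, mul_one_div]
      have : 0 ≤ (q : ℝ) / r := by positivity
      linarith
  refine (Finset.sum_le_sum h1).trans ?_
  rw [Finset.sum_add_distrib, ← Finset.mul_sum, ← Finset.mul_sum,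
    Finset.sum_range_reflect (fun k => 1 / ((k : ℝ) + 1))]
  have h2 := sum_inv_le q
  have h3 : ∑ r ∈ Finset.range q, 1 / (r : ℝ) ≤ 2 * √q := by
    cases q with
    | zero => simp
    | succ q =>
      rw [Finset.sum_range_succ']
      push_cast
      simp only [div_zero, add_zero]
      refine (sum_inv_le q).trans ?_
      gcongr
      linarith
  have hq : (0 : ℝ) ≤ q := Nat.cast_nonneg q
  nlinarith

theorem card_range_le_real (q : ℕ) (y : ℝ) (hy : 0 ≤ y) :
    ∑ r ∈ Finset.range q, (if (r : ℝ) ≤ y then (1 : ℝ) else 0) ≤ y + 1 := by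
  rw [← Finset.sum_filter, Finset.sum_const, nsmul_eq_mul, mul_one]
  have : (Finset.range q).filter (fun r : ℕ => (r : ℝ) ≤ y) ⊆ Finset.range (⌊y⌋₊ + 1) := by
    intro r hr
    rw [Finset.mem_filter] at hr
    exact Finset.mem_range.2 (Nat.lt_succ_of_le (Nat.le_floor hr.2))
  have h := Finset.card_le_card this
  rw [Finset.card_range] at h
  calc _ ≤ ((⌊y⌋₊ + 1 : ℕ) : ℝ) := by exact_mod_cast h
    _ ≤ y + 1 := by push_cast; linarith [Nat.floor_le hy]

theorem sum_distInt_lt_le (q : ℕ) (t : ℝ) (ht : 0 ≤ t) :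
    ∑ r ∈ Finset.range q, (if distInt ((r : ℝ) / q) < t then (1 : ℝ) else 0) ≤
      2 * (q * t) + 2 := by
  have h1 : ∀ r ∈ Finset.range q, (if distInt ((r : ℝ) / q) < t then (1 : ℝ) else 0) ≤
      (if (r : ℝ) ≤ q * t then (1 : ℝ) else 0) +
        (if ((q - 1 - r : ℕ) : ℝ) ≤ q * t then (1 : ℝ) else 0) := by
    intro r hr
    have hr := Finset.mem_range.1 hr
    have hq : (0 : ℝ) < q := by exact_mod_cast (Nat.zero_le r).trans_lt hr
    have e : ((q - 1 - r : ℕ) : ℝ) = q - r - 1 := by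
      rw [Nat.sub_sub, Nat.cast_sub (by omega)]; push_cast; ring
    rw [e, distInt_natCast_div hr]
    by_cases h : min ((r : ℝ) / q) (1 - (r : ℝ) / q) < t
    · rw [if_pos h]
      rcases min_lt_iff.1 h with h | h
      · rw [div_lt_iff₀ hq] at h
        rw [if_pos (by linarith : (r : ℝ) ≤ q * t)]
        split_ifs <;> norm_num
      · rw [one_sub_div hq.ne', div_lt_iff₀ hq] at h
        rw [if_pos (by linarith : (q : ℝ) - r - 1 ≤ q * t)]
        split_ifs <;> norm_num
    · rw [if_neg h]
      split_ifs <;> norm_num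
  refine (Finset.sum_le_sum h1).trans ?_
  rw [Finset.sum_add_distrib,
    Finset.sum_range_reflect (fun k => if (k : ℝ) ≤ q * t then (1 : ℝ) else 0)]
  have := card_range_le_real q (q * t) (by positivity)
  linarith

theorem sum_mul_antitone_nonneg (c w : ℕ → ℝ) (hw : Antitone w) (hw0 : ∀ n, 0 ≤ w n) (n : ℕ)
    (hc : ∀ m ≤ n, 0 ≤ ∑ i ∈ Finset.range m, c i) :
    0 ≤ ∑ i ∈ Finset.range n, c i * w i := by
  have key : ∀ m ≤ n, w m * ∑ i ∈ Finset.range m, c i ≤ ∑ i ∈ Finset.range m, c i * w i := by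
    intro m
    induction m with
    | zero => simp
    | succ m ih =>
      intro hm
      have h1 := ih (by omega)
      have h2 := hc (m + 1) hm
      calc _ ≤ w m * ∑ i ∈ Finset.range (m + 1), c i :=
            mul_le_mul_of_nonneg_right (hw (Nat.le_succ m)) h2
        _ ≤ _ := by rw [Finset.sum_range_succ, Finset.sum_range_succ]; linarith
  exact (mul_nonneg (hw0 n) (hc n le_rfl)).trans (key n le_rfl)

/-- The second difference of a sequence. -/
def secondDiff (f : ℕ → ℝ) (n : ℕ) : ℝ := f (n + 2) - 2 * f (n + 1) + f n

theorem diff_shift_eq_sum (f : ℕ → ℝ) (h n : ℕ) :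
    f (n + 1 + h) - f (n + 1) - (f (n + h) - f n) =
      ∑ i ∈ Finset.range h, secondDiff f (n + i) := by
  induction h with
  | zero => simp
  | succ h ih =>
    rw [Finset.sum_range_succ, ← ih, secondDiff, show n + 1 + (h + 1) = n + h + 2 by ring,
      show n + 1 + h = n + h + 1 by ring, show n + (h + 1) = n + h + 1 by ring]
    ring

theorem monotone_diff_shift (f : ℕ → ℝ) (hf : Monotone (secondDiff f)) (h : ℕ) :
    Monotone fun n => f (n + 1 + h) - f (n + 1) - (f (n + h) - f n) := by
  intro a b hab
  simp only [diff_shift_eq_sum]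
  exact Finset.sum_le_sum fun i _ => hf (by omega)

theorem diff_shift_bounds (f : ℕ → ℝ) (N h : ℕ) (lo hi : ℝ)
    (hs : ∀ n < N, lo ≤ secondDiff f n ∧ secondDiff f n ≤ hi) (n : ℕ) (hn : n + h < N + 1) :
    h * lo ≤ f (n + 1 + h) - f (n + 1) - (f (n + h) - f n) ∧
      f (n + 1 + h) - f (n + 1) - (f (n + h) - f n) ≤ h * hi := by
  rw [diff_shift_eq_sum]
  constructor
  · have := Finset.card_nsmul_le_sum (Finset.range h) (fun i => secondDiff f (n + i)) lo
      fun i hi => (hs _ (by have := Finset.mem_range.1 hi; omega)).1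
    simpa using this
  · have := Finset.sum_le_card_nsmul (Finset.range h) (fun i => secondDiff f (n + i)) hi
      fun i hi => (hs _ (by have := Finset.mem_range.1 hi; omega)).2
    simpa using this

theorem secondDiff_growth (f : ℕ → ℝ) (lo hi : ℝ)
    (hf : ∀ n, lo ≤ secondDiff f (n + 1) - secondDiff f n ∧
      secondDiff f (n + 1) - secondDiff f n ≤ hi) (k n : ℕ) :
    n * lo ≤ secondDiff f (k + n) - secondDiff f k ∧
      secondDiff f (k + n) - secondDiff f k ≤ n * hi := by
  induction n with
  | zero => simp
  | succ n ih =>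
    have := hf (k + n)
    rw [← add_assoc]
    push_cast
    constructor <;> linarith [ih.1, ih.2, this.1, this.2]

theorem sum_hits_le (C : ℝ) (hC : 1 ≤ C) (M q : ℕ) (hM : 1 ≤ M) (hq : M ≤ q)
    (hq' : q ≤ M ^ 2) (A : ℤ) (hA : IsCoprime A (q : ℤ)) :
    ∑ i ∈ Finset.range (M ^ 2 - 1),
      (if distInt (((1 + i : ℕ) : ℝ) * (A / q)) < 2 * (1 / q + ((1 + i : ℕ) : ℝ) * C / M ^ 3)
        then (1 : ℝ) else 0) * (1 / √((i : ℝ) + 1)) ≤ 42 * C := by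
  have hM' : (1 : ℝ) ≤ M := by exact_mod_cast hM
  have hM0 : (0 : ℝ) < M := by linarith
  have hqM : (M : ℝ) ≤ q := by exact_mod_cast hq
  have hqM2 : (q : ℝ) ≤ M ^ 2 := by exact_mod_cast hq'
  have hq0 : (0 : ℝ) < q := by linarith
  set a : ℕ → ℝ := fun i =>
    if distInt (((1 + i : ℕ) : ℝ) * (A / q)) < 2 * (1 / q + ((1 + i : ℕ) : ℝ) * C / M ^ 3)
      then (1 : ℝ) else 0 with ha
  have hcount : ∀ m ≤ M ^ 2 - 1, ∑ i ∈ Finset.range m, a i ≤ 14 * C * (1 + m / M) := by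
    intro m hm
    set t : ℝ := 2 * (1 / q + m * C / M ^ 3) with ht
    have ht0 : 0 ≤ t := by positivity
    have hm2 : (m : ℝ) + 1 ≤ M ^ 2 := by
      have : 1 ≤ M ^ 2 := Nat.one_le_pow _ _ hM
      exact_mod_cast (by omega : m + 1 ≤ M ^ 2)
    have e1 : ∑ i ∈ Finset.range m, a i ≤
        ∑ h ∈ Finset.range (m + 1), (if distInt (h * (A / q)) < t then (1 : ℝ) else 0) := by
      rw [Finset.sum_range_succ']
      refine le_add_of_le_of_nonneg (Finset.sum_le_sum fun i hi => ?_) (by split_ifs <;> norm_num)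
      have hi : ((1 + i : ℕ) : ℝ) ≤ m := by
        exact_mod_cast (by have := Finset.mem_range.1 hi; omega : 1 + i ≤ m)
      simp only [ha]
      rw [add_comm 1 i] at hi ⊢
      by_cases hlt : distInt (((i + 1 : ℕ) : ℝ) * (A / q)) <
          2 * (1 / q + ((i + 1 : ℕ) : ℝ) * C / M ^ 3)
      · rw [if_pos hlt, if_pos]
        refine hlt.trans_le ?_
        rw [ht]
        gcongr
      · rw [if_neg hlt]
        split_ifs <;> norm_num
    refine e1.trans ((sum_distInt_le (fun x => if x < t then (1 : ℝ) else 0)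
      (fun x => by split_ifs <;> norm_num) (by omega) A hA (m + 1)).trans ?_)
    have e2 := sum_distInt_lt_le q t ht0
    refine (mul_le_mul_of_nonneg_left e2 (by positivity)).trans ?_
    have e3 : (q : ℝ) * t = 2 + 2 * (q * (m * C / M ^ 3)) := by
      rw [ht]; field_simp
    have e4 : ((m + 1 : ℕ) : ℝ) / q ≤ (m + 1) / M := by
      push_cast
      gcongr
    set u : ℝ := m / M with hu
    have hu0 : 0 ≤ u := by positivity
    have e5 : ((m : ℝ) + 1) / M ≤ u + 1 := by
      rw [add_div]; gcongr; rw [div_le_one hM0]; exact hM'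
    have e6 : (q : ℝ) * (m * C / M ^ 3) ≤ C * u := by
      calc (q : ℝ) * (m * C / M ^ 3) ≤ M ^ 2 * (m * C / M ^ 3) := by gcongr
        _ = C * u := by rw [hu]; field_simp
    have e7 : ((m : ℝ) + 1) / q * (q * (m * C / M ^ 3)) ≤ C * u := by
      calc ((m : ℝ) + 1) / q * (q * (m * C / M ^ 3)) = ((m : ℝ) + 1) * (m * C / M ^ 3) := by
            field_simp
        _ ≤ M ^ 2 * (m * C / M ^ 3) := by gcongr
        _ = C * u := by rw [hu]; field_simp
    rw [e3]
    push_cast at e4 ⊢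
    have hCu : u ≤ C * u := by nlinarith
    nlinarith [e4, e5, e6, e7]
  set w : ℕ → ℝ := fun i => 1 / √((i : ℝ) + 1) with hw
  have hwanti : Antitone w := by
    intro i j hij
    simp only [hw]
    gcongr
  set b : ℕ → ℝ := fun i => (if i = 0 then 14 * C else 0) + 14 * C / M with hb
  have hbsum : ∀ m, 1 ≤ m → ∑ i ∈ Finset.range m, b i = 14 * C * (1 + m / M) := by
    intro m hm
    simp only [hb, Finset.sum_add_distrib, Finset.sum_ite_eq', Finset.mem_range]
    rw [if_pos (by omega)]
    simp
    ring
  have hmain := sum_mul_antitone_nonneg (fun i => b i - a i) w hwanti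
    (fun n => by simp only [hw]; positivity) (M ^ 2 - 1) (fun m hm => by
      rw [Finset.sum_sub_distrib]
      rcases Nat.eq_zero_or_pos m with rfl | h
      · simp
      · rw [hbsum m h]
        linarith [hcount m hm])
  simp only [sub_mul, Finset.sum_sub_distrib] at hmain
  refine (sub_nonneg.1 hmain).trans ?_
  simp only [hb, add_mul, Finset.sum_add_distrib, ← Finset.mul_sum]
  have h1 : ∑ i ∈ Finset.range (M ^ 2 - 1), w i ≤ 2 * M := by
    refine (sum_inv_sqrt_le _).trans ?_
    gcongr
    rw [Real.sqrt_le_left hM0.le]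
    exact_mod_cast Nat.sub_le _ _
  have h2 : ∑ i ∈ Finset.range (M ^ 2 - 1), (if i = 0 then 14 * C else 0) * w i ≤ 14 * C := by
    simp only [ite_mul, zero_mul, Finset.sum_ite_eq']
    split_ifs
    · simp [hw]
    · positivity
  have h3 : 14 * C / M * ∑ i ∈ Finset.range (M ^ 2 - 1), w i ≤ 28 * C := by
    calc _ ≤ 14 * C / M * (2 * M) := by gcongr
      _ = 28 * C := by field_simp; norm_num
  linarith

theorem minor_arc_bound (C : ℝ) (hC : 1 ≤ C) (M q : ℕ) (hM : 4 * C ≤ M) (f : ℕ → ℝ)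
    (hf : ∀ n, 1 / (M : ℝ) ^ 6 ≤ secondDiff f (n + 1) - secondDiff f n ∧
      secondDiff f (n + 1) - secondDiff f n ≤ C / (M : ℝ) ^ 6)
    (hq : M ≤ q) (hq' : q ≤ M ^ 2) (A : ℤ) (hA : IsCoprime A (q : ℤ))
    (hβ : |secondDiff f 0 - A / q| ≤ 1 / (q * M ^ 2)) (N : ℕ) (hN : N ≤ M ^ 3) :
    ‖∑ n ∈ Finset.range N, e2pi (f n)‖ ≤ 40 * C * M ^ 2 := by
  have hM4 : (4 : ℝ) ≤ M := by linarith
  have hM0 : (0 : ℝ) < M := by linarith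
  have hM1 : 1 ≤ M := by exact_mod_cast (by linarith : (1 : ℝ) ≤ M)
  have hqM : (M : ℝ) ≤ q := by exact_mod_cast hq
  have hqM2 : (q : ℝ) ≤ M ^ 2 := by exact_mod_cast hq'
  have hq0 : (0 : ℝ) < q := by linarith
  have hNM : (N : ℝ) ≤ M ^ 3 := by exact_mod_cast hN
  rcases Nat.lt_or_ge N (M ^ 2) with hlt | hge
  · refine (norm_sum_e2pi_le N f).trans ?_
    have : (N : ℝ) ≤ M ^ 2 := by exact_mod_cast hlt.le
    nlinarith [sq_nonneg (M : ℝ)]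
  have hs : ∀ n < N, secondDiff f 0 ≤ secondDiff f n ∧
      secondDiff f n ≤ secondDiff f 0 + C / M ^ 3 := by
    intro n hn
    have h := secondDiff_growth f _ _ hf 0 n
    rw [zero_add] at h
    have h1 : 0 ≤ (n : ℝ) * (1 / (M : ℝ) ^ 6) := by positivity
    have h2 : (n : ℝ) * (C / (M : ℝ) ^ 6) ≤ C / M ^ 3 := by
      have : (n : ℝ) ≤ M ^ 3 := by exact_mod_cast (hn.le.trans hN)
      calc _ ≤ (M : ℝ) ^ 3 * (C / (M : ℝ) ^ 6) := by gcongr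
        _ = _ := by field_simp
    constructor <;> linarith [h.1, h.2]
  have hmono : Monotone (secondDiff f) := monotone_nat_of_le_succ fun n => by
    have h1 := (hf n).1
    have h2 : 0 ≤ 1 / (M : ℝ) ^ 6 := by positivity
    linarith
  have hB : ∀ i ∈ Finset.range (M ^ 2 - 1),
      ‖∑ n ∈ Finset.range (N - (1 + i)), e2pi (f (n + (1 + i)) - f n)‖ ≤
      8 * M ^ 3 * ((if distInt (((1 + i : ℕ) : ℝ) * (A / q)) <
        2 * (1 / q + ((1 + i : ℕ) : ℝ) * C / M ^ 3) then (1 : ℝ) else 0) * (1 / √((i : ℝ) + 1))) +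
      4 * (1 / distInt (((1 + i : ℕ) : ℝ) * (A / q))) := by
    intro i hi
    have hi := Finset.mem_range.1 hi
    obtain ⟨h, hh⟩ : ∃ h, h = 1 + i := ⟨_, rfl⟩
    have hhM : (h : ℝ) ≤ M ^ 2 := by exact_mod_cast (by omega : h ≤ M ^ 2)
    have hh1 : (1 : ℝ) ≤ h := by exact_mod_cast (by omega : 1 ≤ h)
    have hi1 : (i : ℝ) + 1 = h := by rw [hh]; push_cast; ring
    rw [hi1, ← hh]
    have hd0 : 0 ≤ distInt (h * (A / q)) := abs_nonneg _
    split_ifs with hlt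
    · refine le_add_of_le_of_nonneg ?_ (by positivity)
      have hμ0 : 0 < (h : ℝ) / M ^ 6 := by positivity
      have hsq : 8 / √((h : ℝ) / M ^ 6) = 8 * M ^ 3 * (1 * (1 / √(h : ℝ))) := by
        rw [Real.sqrt_div (by positivity), show (M : ℝ) ^ 6 = (M ^ 3) ^ 2 by ring,
          Real.sqrt_sq (by positivity)]
        field_simp
      rw [← hsq]
      have hb := diff_shift_bounds f N h _ _ hs
      refine second_difference_test (fun n => f (n + h) - f n) (N - h) (h / M ^ 6)
        (h * secondDiff f 0) hμ0 ?_ ?_ ?_ ?_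
      · rw [div_le_div_iff₀ (by positivity) (by norm_num)]
        have : (M : ℝ) ^ 6 = M ^ 2 * M ^ 4 := by ring
        have h4 : (4 : ℝ) ^ 4 ≤ M ^ 4 := by gcongr
        nlinarith
      · intro n
        have e1 := diff_shift_eq_sum f h n
        have e2 := diff_shift_eq_sum f h (n + 1)
        have e3 := Finset.card_nsmul_le_sum (Finset.range h)
          (fun i => secondDiff f (n + 1 + i) - secondDiff f (n + i)) (1 / (M : ℝ) ^ 6)
          fun i _ => by rw [show n + 1 + i = n + i + 1 by ring]; exact (hf (n + i)).1
        rw [Finset.sum_sub_distrib, ← e1, ← e2, Finset.card_range, nsmul_eq_mul,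
          mul_one_div] at e3
        exact e3
      · intro n hn
        exact (hb n (by omega)).1
      · intro n hn
        refine (hb n (by omega)).2.trans ?_
        rw [mul_add]
        gcongr
        calc (h : ℝ) * (C / M ^ 3) ≤ M ^ 2 * (C / M ^ 3) := by gcongr
          _ = C / M := by field_simp
          _ ≤ 1 / 4 := by rw [div_le_div_iff₀ hM0 (by norm_num)]; linarith
    · rw [zero_mul, mul_zero, zero_add, mul_one_div]
      have hlt := not_lt.1 hlt
      have hε : 0 < 1 / (q : ℝ) + h * C / M ^ 3 := by positivity
      refine kuzmin_landau_distInt (fun n => f (n + h) - f n) (N - h)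
        (monotone_diff_shift f hmono h) _ _ hlt (by linarith) ?_
      intro n hn
      have hb := diff_shift_bounds f N h _ _ hs n (by omega)
      have hhβ : |(h : ℝ) * secondDiff f 0 - h * (A / q)| ≤ 1 / q := by
        rw [← mul_sub, abs_mul, abs_of_pos (by linarith : (0 : ℝ) < h)]
        calc _ ≤ (M : ℝ) ^ 2 * (1 / (q * M ^ 2)) := by gcongr
          _ = 1 / q := by field_simp
      rw [abs_le] at hhβ ⊢
      have : 0 ≤ (h : ℝ) * C / M ^ 3 := by positivity
      rw [mul_add, ← mul_div_assoc] at hb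
      constructor <;> linarith [hb.1, hb.2, hhβ.1, hhβ.2]
  have hsum : ∑ h ∈ Finset.Ico 1 (M ^ 2),
      ‖∑ n ∈ Finset.range (N - h), e2pi (f (n + h) - f n)‖ ≤ 368 * C * M ^ 3 := by
    rw [Finset.sum_Ico_eq_sum_range]
    refine (Finset.sum_le_sum hB).trans ?_
    rw [Finset.sum_add_distrib, ← Finset.mul_sum, ← Finset.mul_sum]
    have h1 := sum_hits_le C hC M q hM1 hq hq' A hA
    have h2 : ∑ i ∈ Finset.range (M ^ 2 - 1), 1 / distInt (((1 + i : ℕ) : ℝ) * (A / q)) ≤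
        8 * M ^ 3 := by
      have e1 := sum_distInt_le (fun x => 1 / |x|) (fun x => by positivity) (by omega) A hA (M ^ 2)
      have e2 : ∀ x, |distInt x| = distInt x := fun x => abs_abs _
      simp only [e2] at e1
      have e3 := sum_inv_distInt_le q
      have e4 : ∑ i ∈ Finset.range (M ^ 2 - 1), 1 / distInt (((1 + i : ℕ) : ℝ) * (A / q)) ≤
          ∑ h ∈ Finset.range (M ^ 2), 1 / distInt (h * (A / q)) := by
        have e5 : M ^ 2 = M ^ 2 - 1 + 1 := by
          have : 1 ≤ M ^ 2 := Nat.one_le_pow _ _ hM1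
          omega
        conv_rhs => rw [e5, Finset.sum_range_succ']
        simp only [add_comm 1]
        exact le_add_of_nonneg_right (one_div_nonneg.2 (abs_nonneg _))
      refine e4.trans (e1.trans ((mul_le_mul_of_nonneg_left e3 (by positivity)).trans ?_))
      have hsq : √(q : ℝ) ≤ M := by
        rw [Real.sqrt_le_left hM0.le]; exact hqM2
      push_cast
      calc ((M : ℝ) ^ 2 / q + 1) * (4 * q * √(q : ℝ)) = 4 * ((M : ℝ) ^ 2 + q) * √(q : ℝ) := by
            field_simp
        _ ≤ 4 * ((M : ℝ) ^ 2 + M ^ 2) * M := by gcongr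
        _ = 8 * (M : ℝ) ^ 3 := by ring
    have h3 : 0 ≤ (M : ℝ) ^ 3 := by positivity
    nlinarith
  have hv := van_der_corput f N (M ^ 2) (Nat.one_le_pow _ _ hM1) hge
  have h4 : ‖∑ n ∈ Finset.range N, e2pi (f n)‖ ^ 2 ≤ (40 * C * M ^ 2) ^ 2 := by
    refine hv.trans ?_
    push_cast
    calc _ ≤ 2 * (M : ℝ) ^ 3 / M ^ 2 * (C * M ^ 3 + 2 * (368 * C * M ^ 3)) := by
          gcongr
          nlinarith [pow_pos hM0 3]
      _ = 1474 * C * (M ^ 2) ^ 2 := by field_simp; ring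
      _ ≤ 1600 * (C * C) * (M ^ 2) ^ 2 := by gcongr <;> nlinarith
      _ = _ := by ring
  exact (sq_le_sq₀ (norm_nonneg _) (by positivity)).1 h4

theorem one_div_le_distInt {A : ℤ} {q h : ℕ} (hq : 0 < q) (hA : IsCoprime A (q : ℤ))
    (hqh : ¬ q ∣ h) : 1 / (q : ℝ) ≤ distInt (h * (A / q)) := by
  have hq' : (0 : ℝ) < q := by exact_mod_cast hq
  unfold distInt
  set r := round ((h : ℝ) * (A / q))
  have e : (h : ℝ) * (A / q) - r = ((h * A - q * r : ℤ) : ℝ) / q := by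
    push_cast
    field_simp
  rw [e, abs_div, abs_of_pos hq']
  have hne : (h * A - q * r : ℤ) ≠ 0 := by
    intro h0
    apply hqh
    have : (q : ℤ) ∣ h * A := ⟨r, by linarith⟩
    exact_mod_cast hA.symm.dvd_of_dvd_mul_right this
  have h1 : (1 : ℝ) ≤ |((h * A - q * r : ℤ) : ℝ)| := by exact_mod_cast Int.one_le_abs hne
  gcongr

theorem sum_dvd_le (F : ℕ → ℝ) (hF : ∀ n, 0 ≤ F n) {q : ℕ} (hq : 0 < q) (H : ℕ) :
    ∑ h ∈ Finset.Ico 1 H, (if q ∣ h then F (h / q) else 0) ≤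
      ∑ k ∈ Finset.range H, F (k + 1) := by
  rw [← Finset.sum_filter]
  have hinj : Set.InjOn (fun h => h / q - 1) ((Finset.Ico 1 H).filter (q ∣ ·) : Set ℕ) := by
    intro a ha b hb hab
    simp only [Finset.coe_filter, Finset.mem_Ico, Set.mem_ofPred_eq] at ha hb
    obtain ⟨⟨ha1, -⟩, a, rfl⟩ := ha
    obtain ⟨⟨hb1, -⟩, b, rfl⟩ := hb
    simp only [Nat.mul_div_cancel_left _ hq] at hab
    have : 0 < a := Nat.pos_of_mul_pos_left ha1
    have : 0 < b := Nat.pos_of_mul_pos_left hb1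
    rw [show a = b by omega]
  have e : ∀ h ∈ (Finset.Ico 1 H).filter (q ∣ ·), F (h / q) = F (h / q - 1 + 1) := by
    intro h hh
    simp only [Finset.mem_filter, Finset.mem_Ico] at hh
    have := Nat.div_pos (Nat.le_of_dvd hh.1.1 hh.2) hq
    rw [Nat.sub_add_cancel this]
  rw [Finset.sum_congr rfl e, ← Finset.sum_image (f := fun k => F (k + 1)) hinj]
  refine Finset.sum_le_sum_of_subset_of_nonneg ?_ fun _ _ _ => hF _
  intro k hk
  simp only [Finset.mem_image, Finset.mem_filter, Finset.mem_Ico] at hk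
  obtain ⟨h, ⟨⟨h1, h2⟩, -⟩, rfl⟩ := hk
  have := Nat.div_le_self h q
  exact Finset.mem_range.2 (by omega)

theorem major_arc_numeric {M E c κ y q N s r z p : ℝ} (hM : 1 ≤ M) (hE : 1 ≤ E) (hc : 1 ≤ c)
    (hκ : 1 ≤ κ) (hz : 0 < z) (hzy : z ^ 4 = y) (hy : y * M ^ 2 ≤ c) (hzr : z * r ≤ c)
    (hEz : E ≤ z * M) (hs : 0 ≤ s) (hsN : s ^ 2 = N) (hs1 : s ≤ 16 * (M * E ^ 2)) (hsr : s ≤ M * r)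
    (hr : 0 < r) (hrM : r ^ 2 = M) (hr' : r ≤ M) (hq : 0 ≤ q) (hqM : q ≤ M) (hp : 0 ≤ p)
    (hpr : p ≤ r) :
    2 * ((1 + 8 * y * N) * N + 32 * (N * p + (1 + 8 * y * N) * (q * p)) +
      (1 + 8 * y * N) * (16 * κ * (s / z ^ 3))) ≤
        2 ^ 18 * κ * c * (M ^ 4 / E + M ^ 3 * E ^ 4) := by
  have hy0 : 0 < y := by rw [← hzy]; positivity
  have hN0 : 0 ≤ N := by rw [← hsN]; positivity
  set X := M ^ 3 * E ^ 4 with hX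
  have hX0 : 0 < X := by positivity
  have hE4 : 1 ≤ E ^ 4 := one_le_pow₀ hE
  have hN1 : N ≤ 256 * (M ^ 2 * E ^ 4) := by
    rw [← hsN]
    calc s ^ 2 ≤ (16 * (M * E ^ 2)) ^ 2 := by gcongr
      _ = _ := by ring
  have hN2 : N ≤ M ^ 3 := by
    rw [← hsN]
    calc s ^ 2 ≤ (M * r) ^ 2 := by gcongr
      _ = M ^ 2 * r ^ 2 := by ring
      _ = _ := by rw [hrM]; ring
  have hXM : M ^ 2 * E ^ 4 ≤ X := by
    rw [hX]; gcongr; norm_num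
  have hcX : X ≤ c * X := le_mul_of_one_le_left hX0.le hc
  have hM2X : M ^ 2 ≤ X := by
    refine le_trans ?_ hXM
    exact le_mul_of_one_le_right (by positivity) hE4
  have a1 : N ≤ 256 * (c * X) := by linarith
  have a2 : y * N * N ≤ 256 * (c * X) := by
    calc y * N * N ≤ y * (256 * (M ^ 2 * E ^ 4)) * M ^ 3 := by gcongr
      _ = (y * M ^ 2) * (256 * X) := by rw [hX]; ring
      _ ≤ c * (256 * X) := by gcongr
      _ = _ := by ring
  have a3 : N * p ≤ 256 * (c * X) := by
    calc N * p ≤ 256 * (M ^ 2 * E ^ 4) * M := by gcongr; linarith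
      _ = 256 * X := by rw [hX]; ring
      _ ≤ _ := by linarith
  have a4 : q * p ≤ c * X := by
    calc q * p ≤ M * M := by gcongr; linarith
      _ = M ^ 2 := by ring
      _ ≤ _ := by linarith
  have a5 : y * N * (q * p) ≤ 256 * (c * X) := by
    calc y * N * (q * p) ≤ y * (256 * (M ^ 2 * E ^ 4)) * (M * M) := by gcongr; linarith
      _ = (y * M ^ 2) * (256 * (M ^ 2 * E ^ 4)) := by ring
      _ ≤ c * (256 * X) := by gcongr
      _ = _ := by ring
  have a6 : s / z ^ 3 ≤ 16 * (M ^ 4 / E) := by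
    rw [← mul_div_assoc, div_le_div_iff₀ (by positivity) (by positivity)]
    calc s * E ≤ 16 * (M * E ^ 2) * E := by gcongr
      _ = 16 * M * E ^ 3 := by ring
      _ ≤ 16 * M * (z * M) ^ 3 := by gcongr
      _ = _ := by ring
  have a7 : y * N * (s / z ^ 3) ≤ 256 * (c * X) := by
    calc y * N * (s / z ^ 3) = z * s * N := by rw [← hzy]; field_simp
      _ ≤ z * (M * r) * (256 * (M ^ 2 * E ^ 4)) := by gcongr
      _ = (z * r) * (256 * X) := by rw [hX]; ring
      _ ≤ c * (256 * X) := by gcongr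
      _ = _ := by ring
  have hW : 0 ≤ M ^ 4 / E := by positivity
  have hcW : M ^ 4 / E ≤ c * (M ^ 4 / E) := le_mul_of_one_le_left hW hc
  have hκc : c * X ≤ κ * (c * X) := le_mul_of_one_le_left (by positivity) hκ
  have hκ0 : 0 ≤ κ := by linarith
  have a8 := mul_le_mul_of_nonneg_left (add_le_add a6 (mul_le_mul_of_nonneg_left a7
    (by norm_num : (0 : ℝ) ≤ 8))) hκ0
  have hκW := mul_le_mul_of_nonneg_left hcW hκ0
  have hκcW : 0 ≤ κ * (c * (M ^ 4 / E)) := by positivity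
  have hκcX : 0 ≤ κ * (c * X) := by positivity
  calc _ = 2 * (N + 8 * (y * N * N) + 32 * (N * p + q * p + 8 * (y * N * (q * p))) +
        16 * (κ * (s / z ^ 3 + 8 * (y * N * (s / z ^ 3))))) := by ring
    _ ≤ 2 * (256 * (c * X) + 8 * (256 * (c * X)) + 32 * (256 * (c * X) + c * X +
        8 * (256 * (c * X))) + 16 * (κ * (16 * (M ^ 4 / E) + 8 * (256 * (c * X))))) := by
        linarith
    _ ≤ 2 ^ 18 * (κ * (c * (M ^ 4 / E)) + κ * (c * X)) := by linarith
    _ = _ := by ring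

theorem major_arc_piece (κ c E θ : ℝ) (M q : ℕ) (f : ℕ → ℝ) (hmono : Monotone (secondDiff f))
    (A : ℤ) (hA : IsCoprime A (q : ℤ)) (hθ : 0 < θ) (hκ : 1 ≤ κ) (hc : 1 ≤ c) (hE : 1 ≤ E)
    (hM8 : 8 * c ≤ (M : ℝ) ^ 2) (hq : 0 < q) (hqM : q ≤ M)
    (hy : q * (κ * θ) ≤ c / (M : ℝ) ^ 2) (hy' : E ^ 4 / (M : ℝ) ^ 4 ≤ q * (κ * θ)) (N : ℕ)
    (hN : (N : ℝ) ≤ 256 * (M ^ 2 * E ^ 4)) (hN3 : N ≤ M ^ 3)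
    (hs : ∀ n < N, A / q + θ ≤ secondDiff f n ∧ secondDiff f n ≤ A / q + κ * θ) :
    ‖∑ n ∈ Finset.range N, e2pi (f n)‖ ^ 2 ≤
      2 ^ 18 * κ * c * (M ^ 4 / E + M ^ 3 * E ^ 4) := by
  have hq0 : (0 : ℝ) < q := by exact_mod_cast hq
  have hqM' : (q : ℝ) ≤ M := by exact_mod_cast hqM
  have hM1 : (1 : ℝ) ≤ M := by exact_mod_cast (hq.trans_le hqM : 1 ≤ M)
  have hM0 : (0 : ℝ) < M := by linarith
  rcases Nat.eq_zero_or_pos N with rfl | hNpos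
  · simp; positivity
  have hN1 : (1 : ℝ) ≤ N := by exact_mod_cast hNpos
  have hN3' : (N : ℝ) ≤ M ^ 3 := by exact_mod_cast hN3
  set y : ℝ := q * (κ * θ) with hydef
  have hκ0 : 0 < κ := by linarith
  have hy0 : 0 < y := by positivity
  have hyM : y * (M : ℝ) ^ 2 ≤ c := (le_div_iff₀ (by positivity)).1 hy
  have hy8 : y ≤ 1 / 8 := by
    by_contra! h
    nlinarith [pow_pos hM0 2]
  set Y : ℝ := 1 / (4 * y) with hY
  have hY2 : 2 ≤ Y := by rw [hY, le_div_iff₀ (by positivity)]; linarith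
  set H : ℕ := min N ⌊Y⌋₊ with hH
  have hHN : H ≤ N := min_le_left _ _
  have hfl : 1 ≤ ⌊Y⌋₊ := Nat.le_floor (by push_cast; linarith)
  have hH1 : 1 ≤ H := le_min hNpos hfl
  have hHY : (H : ℝ) ≤ Y :=
    le_trans (by exact_mod_cast min_le_right _ _) (Nat.floor_le (by linarith))
  have hHy : (H : ℝ) * y ≤ 1 / 4 := by
    calc (H : ℝ) * y ≤ Y * y := by gcongr
      _ = 1 / 4 := by rw [hY]; field_simp
  have hH0 : (0 : ℝ) < H := by exact_mod_cast hH1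
  have hNH : (N : ℝ) / H ≤ 1 + 8 * y * N := by
    rcases min_choice N ⌊Y⌋₊ with h | h
    · rw [hH, h, div_self (by linarith)]
      have : 0 ≤ 8 * y * N := by positivity
      linarith
    · have h1 : Y / 2 ≤ H := by
        rw [hH, h]
        have := Nat.lt_floor_add_one Y
        linarith
      calc (N : ℝ) / H ≤ N / (Y / 2) := by gcongr
        _ = 8 * y * N := by rw [hY]; field_simp; norm_num
        _ ≤ _ := by linarith
  have hT : ∀ h ∈ Finset.Ico 1 H, ‖∑ n ∈ Finset.range (N - h), e2pi (f (n + h) - f n)‖ ≤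
      4 * (1 / distInt (h * (A / q))) +
        (if q ∣ h then min (N : ℝ) (2 / (q * θ) / (h / q : ℕ)) else 0) := by
    intro h hh
    obtain ⟨hh1, hhH⟩ := Finset.mem_Ico.1 hh
    have hh0 : (0 : ℝ) < h := by exact_mod_cast hh1
    have hd0 : 0 ≤ distInt (h * (A / q)) := abs_nonneg _
    have hhκ : h * (κ * θ) ≤ 1 / (4 * q) := by
      rw [le_div_iff₀ (by positivity)]
      have : (h : ℝ) ≤ H := by exact_mod_cast hhH.le
      calc h * (κ * θ) * (4 * q) = 4 * (h * y) := by rw [hydef]; ring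
        _ ≤ 4 * (H * y) := by gcongr
        _ ≤ 1 := by linarith
    have hθκ : h * θ ≤ h * (κ * θ) := by
      gcongr; exact le_mul_of_one_le_left hθ.le hκ
    have h4q : 1 / (4 * (q : ℝ)) ≤ 1 / 4 := by
      have : (1 : ℝ) ≤ q := by exact_mod_cast hq
      gcongr; linarith
    have hb := diff_shift_bounds f N h _ _ hs
    have hmono' := monotone_diff_shift f hmono h
    split_ifs with hqh
    · refine le_add_of_nonneg_of_le (by positivity) (le_min ?_ ?_)
      · exact (norm_sum_e2pi_le _ _).trans (by exact_mod_cast Nat.sub_le _ _)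
      · obtain ⟨k, rfl⟩ := hqh
        rw [Nat.mul_div_cancel_left _ hq, div_div, show (q : ℝ) * θ * k = ((q * k : ℕ) : ℝ) * θ by
          push_cast; ring]
        have e : ((q * k : ℕ) : ℝ) * (A / q) = ((k * A : ℤ) : ℝ) := by
          push_cast; field_simp
        refine kuzmin_landau _ _ hmono' (k * A) _ (by positivity) (by linarith) ?_ ?_
        · intro n hn
          have := (hb n (by omega)).1
          rw [mul_add, e] at this
          exact this
        · intro n hn
          have := (hb n (by omega)).2
          rw [mul_add, e] at this
          linarith
    · rw [add_zero, mul_one_div]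
      have hd := one_div_le_distInt hq hA hqh
      have hd' : 0 < 1 / (q : ℝ) := by positivity
      refine kuzmin_landau_distInt _ _ hmono' _ (h * (κ * θ)) ?_ (by linarith) ?_
      · refine le_trans ?_ hd
        calc 2 * (h * (κ * θ)) ≤ 2 * (1 / (4 * (q : ℝ))) := by gcongr
          _ = 1 / 2 * (1 / q) := by field_simp; norm_num
          _ ≤ 1 / q := by linarith
      · intro n hn
        have := hb n (by omega)
        rw [mul_add, mul_add] at this
        have h0 : 0 ≤ h * θ := by positivity
        rw [abs_le]
        constructor <;> linarith [this.1, this.2]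
  set z : ℝ := √√y with hz
  have hz0 : 0 < z := Real.sqrt_pos.2 (Real.sqrt_pos.2 hy0)
  have h4 : ∀ t : ℝ, 0 ≤ t → √√t ^ 4 = t := fun t ht => by
    rw [show 4 = 2 * 2 from rfl, pow_mul, Real.sq_sqrt (Real.sqrt_nonneg _), Real.sq_sqrt ht]
  have hzy : z ^ 4 = y := h4 y hy0.le
  have hsum1 : ∑ h ∈ Finset.Ico 1 H, 1 / distInt (h * (A / q)) ≤ 4 * ((H + q) * √(q : ℝ)) := by
    have e1 := sum_distInt_le (fun x => 1 / |x|) (fun x => by positivity) hq A hA H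
    have e2 : ∀ x, |distInt x| = distInt x := fun x => abs_abs _
    simp only [e2] at e1
    have e3 := sum_inv_distInt_le q
    have e4 : ∑ h ∈ Finset.Ico 1 H, 1 / distInt (h * (A / q)) ≤
        ∑ h ∈ Finset.range H, 1 / distInt (h * (A / q)) := by
      refine Finset.sum_le_sum_of_subset_of_nonneg ?_ fun _ _ _ => one_div_nonneg.2 (abs_nonneg _)
      intro h hh
      exact Finset.mem_range.2 (Finset.mem_Ico.1 hh).2
    refine e4.trans (e1.trans ((mul_le_mul_of_nonneg_left e3 (by positivity)).trans (le_of_eq ?_)))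
    field_simp
  have hsum2 : ∑ h ∈ Finset.Ico 1 H,
      (if q ∣ h then min (N : ℝ) (2 / (q * θ) / (h / q : ℕ)) else 0) ≤
        8 * κ * (√(N : ℝ) / z ^ 3) := by
    refine (sum_dvd_le (fun k => min (N : ℝ) (2 / (q * θ) / k)) (fun k => by positivity)
      hq H).trans ?_
    have e1 := sum_min_div_le H N (2 / (q * θ)) (by positivity) (by positivity)
    push_cast
    refine e1.trans ?_
    have e2 : 2 / (q * θ) = 2 * κ / y := by rw [hydef]; field_simp
    have e3 : √√(2 / (q * θ)) = √√(2 * κ) / z := by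
      rw [e2, Real.sqrt_div (by positivity), Real.sqrt_div (by positivity)]
    have e4 : √√(2 * κ) ^ 3 ≤ 2 * κ := by
      have e5 : 1 ≤ √√(2 * κ) := by
        rw [Real.one_le_sqrt, Real.one_le_sqrt]; linarith
      calc √√(2 * κ) ^ 3 ≤ √√(2 * κ) ^ 4 := pow_le_pow_right₀ e5 (by norm_num)
        _ = _ := h4 _ (by positivity)
    have e6 : √√(H : ℝ) ≤ √√(N : ℝ) := by gcongr
    have e7 : √√(N : ℝ) * √√(N : ℝ) = √(N : ℝ) := Real.mul_self_sqrt (Real.sqrt_nonneg _)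
    rw [e3, div_pow]
    calc 4 * (√√(N : ℝ) * (√√(2 * κ) ^ 3 / z ^ 3) * √√(H : ℝ)) ≤
        4 * (√√(N : ℝ) * (2 * κ / z ^ 3) * √√(N : ℝ)) := by gcongr
      _ = 4 * (2 * κ / z ^ 3) * (√√(N : ℝ) * √√(N : ℝ)) := by ring
      _ = _ := by rw [e7]; ring
  have hsum := Finset.sum_le_sum hT
  rw [Finset.sum_add_distrib, ← Finset.mul_sum] at hsum
  have hsum' : ∑ h ∈ Finset.Ico 1 H, ‖∑ n ∈ Finset.range (N - h), e2pi (f (n + h) - f n)‖ ≤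
      16 * ((H + q) * √(q : ℝ)) + 8 * κ * (√(N : ℝ) / z ^ 3) := by linarith
  refine (van_der_corput f N H hH1 hHN).trans ?_
  have hsM : √(M : ℝ) ^ 2 = M := Real.sq_sqrt hM0.le
  have hsM0 : 0 < √(M : ℝ) := Real.sqrt_pos.2 hM0
  refine le_trans ?_ (major_arc_numeric (r := √(M : ℝ)) (s := √(N : ℝ)) (z := z) (y := y)
    (p := √(q : ℝ)) (q := q) (N := N) hM1 hE hc hκ hz0 hzy hyM ?_ ?_ (Real.sqrt_nonneg _)
    (Real.sq_sqrt (by linarith)) ?_ ?_ hsM0 hsM ?_ hq0.le hqM' (Real.sqrt_nonneg _) (by gcongr))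
  · calc 2 * (N : ℝ) / H *
        (N + 2 * ∑ h ∈ Finset.Ico 1 H, ‖∑ n ∈ Finset.range (N - h), e2pi (f (n + h) - f n)‖) ≤
        2 * (N : ℝ) / H *
        (N + 2 * (16 * ((H + q) * √(q : ℝ)) + 8 * κ * (√(N : ℝ) / z ^ 3))) := by gcongr
      _ = 2 * (N / H * N + 32 * (N * √(q : ℝ) + N / H * (q * √(q : ℝ))) +
        N / H * (16 * κ * (√(N : ℝ) / z ^ 3))) := by field_simp; ring
      _ ≤ _ := by gcongr
  · rw [← pow_le_pow_iff_left₀ (by positivity) (by linarith) (by norm_num : 4 ≠ 0), mul_pow, hzy,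
      show √(M : ℝ) ^ 4 = (√(M : ℝ) ^ 2) ^ 2 by ring, hsM]
    exact hyM.trans (le_self_pow₀ hc (by norm_num))
  · rw [← pow_le_pow_iff_left₀ (by positivity) (by positivity) (by norm_num : 4 ≠ 0), mul_pow, hzy]
    exact (div_le_iff₀ (by positivity)).1 hy'
  · rw [Real.sqrt_le_left (by positivity)]
    calc (N : ℝ) ≤ _ := hN
      _ = _ := by ring
  · rw [Real.sqrt_le_left (by positivity), mul_pow, hsM]
    calc (N : ℝ) ≤ _ := hN3'
      _ = _ := by ring
  · rw [Real.sqrt_le_left (by positivity)]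
    nlinarith

theorem norm_dyadic_piece_le (C c₀ : ℝ) (hC : 1 ≤ C) (hc₀ : 1 ≤ c₀) (M q : ℕ) (f : ℕ → ℝ)
    (hf : ∀ n, 1 / (M : ℝ) ^ 6 ≤ secondDiff f (n + 1) - secondDiff f n ∧
      secondDiff f (n + 1) - secondDiff f n ≤ C / (M : ℝ) ^ 6)
    (hM : 8 * (256 * C * c₀) ≤ (M : ℝ) ^ 2) (A : ℤ) (hA : IsCoprime A (q : ℤ)) (hq : 0 < q)
    (hqM : q ≤ M) (h0 : A / q ≤ secondDiff f 0) (N : ℕ) (hN : N ≤ M ^ 3)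
    (hs : ∀ n < N, secondDiff f n - A / q ≤ c₀ / (q * M ^ 2)) (j : ℕ)
    (hXN : 256 ^ j * M ^ 2 < N) (hNX : N ≤ 256 ^ (j + 1) * M ^ 2) :
    ‖∑ n ∈ Finset.range (N - 256 ^ j * M ^ 2), e2pi (f (256 ^ j * M ^ 2 + n))‖ ≤
      2 ^ 17 * C * c₀ * M ^ 2 * (1 / 2 ^ j + 16 ^ j / √(M : ℝ)) := by
  have hM1 : 1 ≤ M := hq.trans_le hqM
  have hM1' : (1 : ℝ) ≤ M := by exact_mod_cast hM1
  have hM0 : (0 : ℝ) < M := by linarith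
  have hq0 : (0 : ℝ) < q := by exact_mod_cast hq
  obtain ⟨X, hX⟩ : ∃ X, X = 256 ^ j * M ^ 2 := ⟨_, rfl⟩
  rw [← hX] at hXN ⊢
  have hNX : N ≤ 256 * X := by rw [hX]; refine hNX.trans (le_of_eq ?_); ring
  have hX' : (X : ℝ) = 256 ^ j * M ^ 2 := by rw [hX]; push_cast; rfl
  have hE4 : ((4 : ℝ) ^ j) ^ 4 = 256 ^ j := by
    rw [← pow_mul, mul_comm, pow_mul]; norm_num
  set θ : ℝ := secondDiff f X - A / q with hθ
  have hgr0 := secondDiff_growth f _ _ hf 0 X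
  rw [zero_add] at hgr0
  have hθX : X * (1 / (M : ℝ) ^ 6) ≤ θ := by linarith [hgr0.1]
  have hX0 : (0 : ℝ) < X := by rw [hX']; positivity
  have hθ0 : 0 < θ := lt_of_lt_of_le (by positivity) hθX
  have hθc : θ ≤ c₀ / (q * M ^ 2) := hs X hXN
  have hshift : ∀ n, secondDiff (fun n => f (X + n)) n = secondDiff f (X + n) := fun n => by
    simp only [secondDiff, add_assoc]
  have hmono : Monotone (secondDiff f) := monotone_nat_of_le_succ fun n => by
    have h1 := (hf n).1
    have h2 : 0 ≤ 1 / (M : ℝ) ^ 6 := by positivity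
    linarith
  have hmain := major_arc_piece (256 * C) (256 * C * c₀) (4 ^ j) θ M q (fun n => f (X + n))
    (fun a b hab => by rw [hshift, hshift]; exact hmono (by omega)) A hA hθ0 (by linarith)
    (by nlinarith) (one_le_pow₀ (by norm_num)) hM hq hqM ?_ ?_ (N - X) ?_ (by omega) ?_
  · have hs2 : √(M : ℝ) ^ 2 = M := Real.sq_sqrt hM0.le
    have hs0 : 0 < √(M : ℝ) := Real.sqrt_pos.2 hM0
    rw [← sq_le_sq₀ (norm_nonneg _) (by positivity)]
    refine hmain.trans ?_
    have e1 : ((2 : ℝ) ^ j) ^ 2 = 4 ^ j := by rw [← pow_mul, mul_comm, pow_mul]; norm_num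
    have e2 : ((16 : ℝ) ^ j) ^ 2 = 256 ^ j := by rw [← pow_mul, mul_comm, pow_mul]; norm_num
    have e3 : (M : ℝ) ^ 4 / 4 ^ j + (M : ℝ) ^ 3 * (4 ^ j) ^ 4 =
        (M ^ 2) ^ 2 * ((1 / 2 ^ j) ^ 2 + (16 ^ j / √(M : ℝ)) ^ 2) := by
      rw [div_pow, div_pow, e1, e2, hs2, hE4]
      field_simp
    rw [e3]
    have hP : 0 ≤ 1 / (2 : ℝ) ^ j := by positivity
    have hQ : 0 ≤ 16 ^ j / √(M : ℝ) := by positivity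
    calc 2 ^ 18 * (256 * C) * (256 * C * c₀) *
          ((M ^ 2) ^ 2 * ((1 / 2 ^ j) ^ 2 + (16 ^ j / √(M : ℝ)) ^ 2)) ≤
          2 ^ 18 * (256 * C) * (256 * C * (c₀ * c₀)) *
          ((M ^ 2) ^ 2 * (1 / 2 ^ j + 16 ^ j / √(M : ℝ)) ^ 2) := by
          gcongr
          · nlinarith
          · nlinarith
      _ = _ := by ring
  · calc (q : ℝ) * (256 * C * θ) ≤ q * (256 * C * (c₀ / (q * M ^ 2))) := by gcongr
      _ = _ := by field_simp
  · rw [hE4]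
    have h1 : (1 : ℝ) ≤ q := by exact_mod_cast hq
    calc (256 : ℝ) ^ j / M ^ 4 = X * (1 / (M : ℝ) ^ 6) := by rw [hX']; field_simp
      _ ≤ 1 * (1 * θ) := by linarith
      _ ≤ q * (256 * C * θ) := by gcongr; linarith
  · rw [hE4, mul_comm ((M : ℝ) ^ 2), ← hX']
    exact_mod_cast (Nat.sub_le _ _).trans hNX
  · intro n hn
    rw [hshift]
    have hg := secondDiff_growth f _ _ hf X n
    have hn' : (n : ℝ) ≤ 255 * X := by exact_mod_cast (by omega : n ≤ 255 * X)
    have h1 : 0 ≤ (n : ℝ) * (1 / (M : ℝ) ^ 6) := by positivity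
    have h2 : (n : ℝ) * (C / (M : ℝ) ^ 6) ≤ 255 * C * θ := by
      calc (n : ℝ) * (C / (M : ℝ) ^ 6) ≤ 255 * X * (C / (M : ℝ) ^ 6) := by gcongr
        _ = 255 * C * (X * (1 / (M : ℝ) ^ 6)) := by ring
        _ ≤ _ := by gcongr
    have h3 : θ ≤ C * θ := le_mul_of_one_le_left hθ0.le hC
    constructor <;> linarith [hg.1, hg.2]

theorem sum_pow_sixteen_le (k : ℕ) : ∑ j ∈ Finset.range (k + 1), (16 : ℝ) ^ j ≤ 2 * 16 ^ k := by
  induction k with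
  | zero => norm_num
  | succ k ih =>
    rw [Finset.sum_range_succ, pow_succ]
    linarith [pow_pos (by norm_num : (0 : ℝ) < 16) k]

theorem sum_inv_two_pow_le (k : ℕ) : ∑ j ∈ Finset.range k, 1 / (2 : ℝ) ^ j ≤ 2 - 2 / 2 ^ k := by
  induction k with
  | zero => norm_num
  | succ k ih =>
    rw [Finset.sum_range_succ]
    refine (add_le_add_left ih _).trans (le_of_eq ?_)
    field_simp
    ring

theorem major_arc_bound_of_le (C c₀ : ℝ) (hC : 1 ≤ C) (hc₀ : 1 ≤ c₀) (M q : ℕ) (f : ℕ → ℝ)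
    (hf : ∀ n, 1 / (M : ℝ) ^ 6 ≤ secondDiff f (n + 1) - secondDiff f n ∧
      secondDiff f (n + 1) - secondDiff f n ≤ C / (M : ℝ) ^ 6)
    (hM : 8 * (256 * C * c₀) ≤ (M : ℝ) ^ 2) (A : ℤ) (hA : IsCoprime A (q : ℤ)) (hq : 0 < q)
    (hqM : q ≤ M) (h0 : A / q ≤ secondDiff f 0) (N : ℕ) (hN : N ≤ M ^ 3)
    (hs : ∀ n < N, secondDiff f n - A / q ≤ c₀ / (q * M ^ 2)) :
    ‖∑ n ∈ Finset.range N, e2pi (f n)‖ ≤ 2 ^ 20 * C * c₀ * M ^ 2 := by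
  have hM1 : 1 ≤ M := hq.trans_le hqM
  have hM1' : (1 : ℝ) ≤ M := by exact_mod_cast hM1
  have hM0 : (0 : ℝ) < M := by linarith
  have hs0 : 0 < √(M : ℝ) := Real.sqrt_pos.2 hM0
  set B : ℝ := 2 ^ 17 * C * c₀ with hB
  have hB0 : 0 < B := by positivity
  have key : ∀ J, ∀ n ≤ N, n ≤ 256 ^ J * M ^ 2 → ‖∑ i ∈ Finset.range n, e2pi (f i)‖ ≤
      M ^ 2 + B * M ^ 2 * ∑ j ∈ Finset.range J, (1 / 2 ^ j + 16 ^ j / √(M : ℝ)) := by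
    intro J
    induction J with
    | zero =>
      intro n _ hn
      refine (norm_sum_e2pi_le n f).trans ?_
      rw [pow_zero, one_mul] at hn
      simp only [Finset.range_zero, Finset.sum_empty, mul_zero, add_zero]
      exact_mod_cast hn
    | succ J ih =>
      intro n hnN hn
      rw [Finset.sum_range_succ, mul_add, ← add_assoc]
      rcases Nat.lt_or_ge (256 ^ J * M ^ 2) n with h | h
      · have e := Finset.sum_range_add (fun i => e2pi (f i)) (256 ^ J * M ^ 2)
          (n - 256 ^ J * M ^ 2)
        rw [Nat.add_sub_cancel' h.le] at e
        rw [e]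
        refine (norm_add_le _ _).trans (add_le_add (ih _ (h.le.trans hnN) le_rfl) ?_)
        exact norm_dyadic_piece_le C c₀ hC hc₀ M q f hf hM A hA hq hqM h0 n (hnN.trans hN)
          (fun i hi => hs i (hi.trans_le hnN)) J h hn
      · refine (ih n hnN h).trans (le_add_of_nonneg_right (by positivity))
  have hlog := Nat.lt_pow_succ_log_self (by norm_num : 1 < 256) M
  have hlog' := Nat.pow_log_le_self 256 (by omega : M ≠ 0)
  set k := Nat.log 256 M
  have h1 := key (k + 1) N le_rfl (hN.trans (by
    rw [pow_succ' M 2]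
    exact Nat.mul_le_mul_right _ hlog.le))
  have h16 : (16 : ℝ) ^ k ≤ √(M : ℝ) := by
    refine Real.le_sqrt_of_sq_le ?_
    rw [← pow_mul, mul_comm, pow_mul]
    norm_num
    exact_mod_cast hlog'
  have h2 : ∑ j ∈ Finset.range (k + 1), (1 / 2 ^ j + 16 ^ j / √(M : ℝ)) ≤ 4 := by
    rw [Finset.sum_add_distrib, ← Finset.sum_div]
    have e1 := sum_inv_two_pow_le (k + 1)
    have e2 : 0 < 2 / (2 : ℝ) ^ (k + 1) := by positivity
    have e3 : (∑ j ∈ Finset.range (k + 1), (16 : ℝ) ^ j) / √(M : ℝ) ≤ 2 := by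
      rw [div_le_iff₀ hs0]
      linarith [sum_pow_sixteen_le k]
    linarith
  refine h1.trans ?_
  have hB1 : 1 ≤ B := by rw [hB]; nlinarith
  have hM2 : 0 < (M : ℝ) ^ 2 := by positivity
  calc _ ≤ (M : ℝ) ^ 2 + B * M ^ 2 * 4 := by gcongr
    _ ≤ 8 * (B * M ^ 2) := by nlinarith
    _ = _ := by rw [hB]; ring

/-- The third difference of a two-sided sequence. -/
def thirdDiff (f : ℤ → ℝ) (n : ℤ) : ℝ := f (n + 3) - 3 * f (n + 2) + 3 * f (n + 1) - f n

theorem secondDiff_shift_sub (f : ℤ → ℝ) (u : ℤ) (n : ℕ) :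
    secondDiff (fun k : ℕ => f (u + k)) (n + 1) - secondDiff (fun k : ℕ => f (u + k)) n =
      thirdDiff f (u + n) := by
  simp only [secondDiff, thirdDiff]
  push_cast
  ring_nf

theorem exists_coprime_approx (β : ℝ) {n : ℕ} (hn : 0 < n) :
    ∃ (A : ℤ) (q : ℕ), 0 < q ∧ q ≤ n ∧ IsCoprime A (q : ℤ) ∧ |β - A / q| ≤ 1 / (q * n) := by
  obtain ⟨r, hr, hd⟩ := Real.exists_rat_abs_sub_le_and_den_le β hn
  refine ⟨r.num, r.den, r.pos, hd, ?_, ?_⟩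
  · rw [Int.isCoprime_iff_gcd_eq_one]
    exact r.reduced
  · have hq : (0 : ℝ) < r.den := by exact_mod_cast r.pos
    have hn' : (0 : ℝ) < n := by exact_mod_cast hn
    rw [← Rat.cast_def]
    refine hr.trans ?_
    rw [mul_comm (r.den : ℝ)]
    gcongr
    linarith

theorem major_arc_bound (C : ℝ) (hC : 1 ≤ C) (M q : ℕ) (f : ℤ → ℝ)
    (hf : ∀ n, 1 / (M : ℝ) ^ 6 ≤ thirdDiff f n ∧ thirdDiff f n ≤ C / (M : ℝ) ^ 6)
    (hM : 8 * (256 * C * (5 * C)) ≤ (M : ℝ) ^ 2) (A : ℤ) (hA : IsCoprime A (q : ℤ)) (hq : 0 < q)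
    (hqM : q ≤ M)
    (hβ : |secondDiff (fun k : ℕ => f k) 0 - A / q| ≤ 1 / (q * M ^ 2)) (N : ℕ) (hN : N ≤ M ^ 3) :
    ‖∑ n ∈ Finset.range N, e2pi (f n)‖ ≤ 2 ^ 24 * C ^ 2 * M ^ 2 := by
  have hM1 : 1 ≤ M := hq.trans_le hqM
  have hM1' : (1 : ℝ) ≤ M := by exact_mod_cast hM1
  have hM0 : (0 : ℝ) < M := by linarith
  have hq0 : (0 : ℝ) < q := by exact_mod_cast hq
  have hqM' : (q : ℝ) ≤ M := by exact_mod_cast hqM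
  have hC0 : 0 < C := by linarith
  obtain ⟨s, hs⟩ : ∃ s : ℤ → ℝ, ∀ n, s n = f (n + 2) - 2 * f (n + 1) + f n := ⟨_, fun _ => rfl⟩
  have hs1 : ∀ n, s (n + 1) - s n = thirdDiff f n := by
    intro n
    rw [hs, hs, thirdDiff]
    ring_nf
  have hshift : ∀ (u : ℤ) (n : ℕ), secondDiff (fun k : ℕ => f (u + k)) n = s (u + n) := by
    intro u n
    rw [hs, secondDiff]
    push_cast
    ring_nf
  have hs0 : secondDiff (fun k : ℕ => f k) 0 = s 0 := by
    have := hshift 0 0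
    simpa using this
  rw [hs0] at hβ
  have hmono : Monotone s := monotone_int_of_le_succ fun n => by
    have h1 := (hf n).1
    rw [← hs1] at h1
    have h2 : 0 ≤ 1 / (M : ℝ) ^ 6 := by positivity
    linarith
  have hgr : ∀ (u : ℤ) (n : ℕ), s (u + n) - s u ≤ n * (C / (M : ℝ) ^ 6) := by
    intro u n
    induction n with
    | zero => simp
    | succ n ih =>
      have h := (hf (u + n)).2
      rw [← hs1] at h
      push_cast
      rw [← add_assoc]
      linarith
  have hgr' : ∀ (u : ℤ) (n : ℕ), n ≤ 4 * M ^ 3 →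
      s (u + n) - s u ≤ 4 * C / (q * M ^ 2) := by
    intro u n hn
    refine (hgr u n).trans ?_
    have hn' : (n : ℝ) ≤ 4 * M ^ 3 := by exact_mod_cast hn
    calc (n : ℝ) * (C / (M : ℝ) ^ 6) ≤ 4 * M ^ 3 * (C / (M : ℝ) ^ 6) := by gcongr
      _ = 4 * C / (M * M ^ 2) := by field_simp
      _ ≤ _ := by gcongr
  rw [abs_le] at hβ
  have h5 : 5 * C / (q * (M : ℝ) ^ 2) = 4 * C / (q * M ^ 2) + C * (1 / (q * M ^ 2)) := by ring
  have hη : 1 / (q * (M : ℝ) ^ 2) ≤ C * (1 / (q * M ^ 2)) :=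
    le_mul_of_one_le_left (by positivity) hC
  have hη0 : 0 ≤ 4 * C / (q * (M : ℝ) ^ 2) := by positivity
  have hM3 : 1 ≤ M ^ 3 := Nat.one_le_pow _ _ hM1
  have hup : ∀ n : ℕ, n ≤ 4 * M ^ 3 → s n - A / q ≤ 5 * C / (q * M ^ 2) := by
    intro n hn
    have := hgr' 0 n hn
    rw [zero_add] at this
    linarith [hβ.2]
  have hlow : A / q - s (-2) ≤ 5 * C / (q * M ^ 2) := by
    have := hgr' (-2) 2 (by omega)
    rw [show (-2 + (2 : ℕ) : ℤ) = 0 by norm_num] at this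
    linarith [hβ.1]
  obtain ⟨k, hkN, hk1, hk2⟩ := exists_threshold (fun n : ℕ => s n)
    (fun a b hab => hmono (by exact_mod_cast hab)) (A / q) N
  rw [sum_range_split _ hkN]
  have hright : ‖∑ n ∈ Finset.range (N - k), e2pi (f (k + n : ℕ))‖ ≤
      2 ^ 20 * C * (5 * C) * M ^ 2 := by
    rcases Nat.eq_zero_or_pos (N - k) with h | h
    · rw [h]; simp; positivity
    push_cast
    refine major_arc_bound_of_le C (5 * C) hC (by linarith) M q (fun n : ℕ => f (k + n)) ?_ hM A
      hA hq hqM ?_ (N - k) (by omega) ?_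
    · intro n
      rw [secondDiff_shift_sub]
      exact hf _
    · rw [hshift]
      simpa using hk2 k le_rfl (by omega)
    · intro n hn
      rw [hshift]
      have := hup (k + n) (by omega)
      push_cast at this
      exact this
  have hleft : ‖∑ n ∈ Finset.range k, e2pi (f n)‖ ≤ 2 ^ 20 * C * (5 * C) * M ^ 2 := by
    rcases Nat.eq_zero_or_pos k with rfl | hk
    · simp; positivity
    rw [← Finset.sum_range_reflect, ← norm_sum_e2pi_neg]
    have e : ∑ n ∈ Finset.range k, e2pi (-f (k - 1 - n : ℕ)) =
        ∑ n ∈ Finset.range k, e2pi (-f (k - 1 - (n : ℤ))) := by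
      refine Finset.sum_congr rfl fun n hn => ?_
      have := Finset.mem_range.1 hn
      rw [show ((k - 1 - n : ℕ) : ℤ) = k - 1 - (n : ℤ) by omega]
    rw [e]
    have hrefl : ∀ n : ℕ, secondDiff (fun n : ℕ => -f (k - 1 - (n : ℤ))) n =
        -s (k - 3 - n) := by
      intro n
      rw [hs, secondDiff]
      push_cast
      ring_nf
    refine major_arc_bound_of_le C (5 * C) hC (by linarith) M q
      (fun n : ℕ => -f (k - 1 - (n : ℤ))) ?_ hM (-A) hA.neg_left hq hqM ?_ k (by omega) ?_
    · intro n
      have h1 := hf (k - 4 - n)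
      rw [← hs1, show (k - 4 - n + 1 : ℤ) = k - 3 - n by ring] at h1
      rw [hrefl, hrefl, show (k - 3 - (n + 1 : ℕ) : ℤ) = k - 4 - n by push_cast; ring]
      constructor <;> linarith [h1.1, h1.2]
    · rw [hrefl]
      have h1 := hk1 (k - 1) (by omega)
      have h2 := hmono (show (k - 3 - (0 : ℕ) : ℤ) ≤ (k - 1 : ℕ) by omega)
      push_cast at h2 ⊢
      rw [neg_div]
      linarith
    · intro n hn
      rw [hrefl]
      have h2 := hmono (show (-2 : ℤ) ≤ k - 3 - n by omega)
      push_cast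
      rw [neg_div]
      linarith
  refine (norm_add_le _ _).trans ((add_le_add hleft hright).trans ?_)
  have : 0 ≤ C ^ 2 * (M : ℝ) ^ 2 := by positivity
  nlinarith

theorem third_difference_block (C : ℝ) (hC : 1 ≤ C) (M : ℕ) (hM : 1 ≤ M) (f : ℤ → ℝ)
    (hf : ∀ n, 1 / (M : ℝ) ^ 6 ≤ thirdDiff f n ∧ thirdDiff f n ≤ C / (M : ℝ) ^ 6)
    (N : ℕ) (hN : N ≤ M ^ 3) :
    ‖∑ n ∈ Finset.range N, e2pi (f n)‖ ≤ 2 ^ 24 * C ^ 2 * M ^ 2 := by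
  have hM1' : (1 : ℝ) ≤ M := by exact_mod_cast hM
  have hM0 : (0 : ℝ) < M := by linarith
  rcases le_total (M : ℝ) (10240 * C ^ 2) with h | h
  · refine (norm_sum_e2pi_le N _).trans ?_
    calc (N : ℝ) ≤ M ^ 3 := by exact_mod_cast hN
      _ = M * M ^ 2 := by ring
      _ ≤ 10240 * C ^ 2 * M ^ 2 := by gcongr
      _ ≤ _ := by gcongr; norm_num
  obtain ⟨A, q, hq, hqM, hA, hβ⟩ := exists_coprime_approx (secondDiff (fun k : ℕ => f k) 0)
    (pow_pos hM 2)
  push_cast at hβ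
  rcases le_total q M with h' | h'
  · exact major_arc_bound C hC M q f hf (by nlinarith) A hA hq h' hβ N hN
  · refine (minor_arc_bound C hC M q (by nlinarith) (fun k : ℕ => f k) ?_ h' hqM A hA hβ N
      hN).trans ?_
    · intro n
      have := secondDiff_shift_sub f 0 n
      simp only [zero_add] at this
      rw [this]
      exact hf n
    · have : C ≤ C ^ 2 := by nlinarith
      have : 0 ≤ (M : ℝ) ^ 2 := by positivity
      calc 40 * C * (M : ℝ) ^ 2 ≤ 40 * C ^ 2 * M ^ 2 := by gcongr
        _ ≤ _ := by gcongr; norm_num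

theorem norm_sum_le_of_blocks (B : ℝ) (T : ℕ) (f : ℤ → ℝ)
    (hB : ∀ (u : ℤ), ∀ N ≤ T, ‖∑ n ∈ Finset.range N, e2pi (f (u + n))‖ ≤ B) (k : ℕ) :
    ∀ (u : ℤ), ∀ N ≤ k * T, ‖∑ n ∈ Finset.range N, e2pi (f (u + n))‖ ≤ k * B := by
  induction k with
  | zero =>
    intro u N hN
    obtain rfl : N = 0 := by simpa using hN
    simp
  | succ k ih =>
    intro u N hN
    rw [Nat.succ_mul] at hN
    have hB0 : 0 ≤ B := (norm_nonneg _).trans (hB 0 0 (Nat.zero_le _))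
    rcases Nat.lt_or_ge N (k * T) with h | h
    · refine (ih u N h.le).trans ?_
      push_cast
      linarith
    · rw [sum_range_split _ h]
      refine (norm_add_le _ _).trans ?_
      have h1 := ih u _ le_rfl
      have h2 := hB (u + (k * T : ℕ)) (N - k * T) (by omega)
      push_cast at h1 h2 ⊢
      simp only [← add_assoc]
      linarith

theorem third_difference_test (C : ℝ) (hC : 1 ≤ C) (lam : ℝ) (hlam : 0 < lam) (f : ℤ → ℝ)
    (hf : ∀ n, lam ≤ thirdDiff f n ∧ thirdDiff f n ≤ C * lam) (N : ℕ) :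
    ‖∑ n ∈ Finset.range N, e2pi (f n)‖ ≤
      2 ^ 38 * C ^ 2 * (N * lam ^ ((1 : ℝ) / 6) + lam ^ (-(1 : ℝ) / 3)) := by
  have hC2 : 1 ≤ C ^ 2 := one_le_pow₀ hC
  rcases le_total 1 lam with h | h
  · refine (norm_sum_e2pi_le N _).trans ?_
    have h1 : 1 ≤ lam ^ ((1 : ℝ) / 6) := Real.one_le_rpow h (by norm_num)
    have h2 : 0 ≤ lam ^ (-(1 : ℝ) / 3) := by positivity
    have h3 : (N : ℝ) ≤ N * lam ^ ((1 : ℝ) / 6) := le_mul_of_one_le_right (Nat.cast_nonneg _) h1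
    have h4 : (1 : ℝ) ≤ 2 ^ 38 * C ^ 2 := by linarith
    have h5 : 0 ≤ N * lam ^ ((1 : ℝ) / 6) + lam ^ (-(1 : ℝ) / 3) := by positivity
    nlinarith
  set x : ℝ := lam ^ (-(1 : ℝ) / 6) with hx
  have hx1 : 1 ≤ x := Real.one_le_rpow_of_pos_of_le_one_of_nonpos hlam h (by norm_num)
  have hx0 : 0 < x := by linarith
  have hx6 : lam * x ^ 6 = 1 := by
    rw [hx, ← Real.rpow_natCast, ← Real.rpow_mul hlam.le]
    norm_num
    rw [Real.rpow_neg_one, mul_inv_cancel₀ hlam.ne']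
  have hxinv : lam ^ ((1 : ℝ) / 6) = 1 / x := by
    rw [hx, one_div x, ← Real.rpow_neg hlam.le]
    norm_num
  have hx2 : lam ^ (-(1 : ℝ) / 3) = x ^ 2 := by
    rw [hx, ← Real.rpow_natCast, ← Real.rpow_mul hlam.le]
    norm_num
  set M : ℕ := ⌈x⌉₊ with hM
  have hxM : x ≤ M := Nat.le_ceil x
  have hMx : (M : ℝ) ≤ 2 * x := by linarith [Nat.ceil_lt_add_one hx0.le]
  have hM0 : (0 : ℝ) < M := by linarith
  have hM1 : 1 ≤ M := by exact_mod_cast hx1.trans hxM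
  have hlow : 1 / (M : ℝ) ^ 6 ≤ lam := by
    rw [div_le_iff₀ (by positivity), ← hx6]
    gcongr
  have hupp : C * lam ≤ 64 * C / (M : ℝ) ^ 6 := by
    rw [le_div_iff₀ (by positivity)]
    calc C * lam * (M : ℝ) ^ 6 ≤ C * lam * (2 * x) ^ 6 := by gcongr
      _ = 64 * C * (lam * x ^ 6) := by ring
      _ = 64 * C := by rw [hx6, mul_one]
  have hblock : ∀ (u : ℤ), ∀ n ≤ M ^ 3, ‖∑ i ∈ Finset.range n, e2pi (f (u + i))‖ ≤
      2 ^ 24 * (64 * C) ^ 2 * M ^ 2 := by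
    intro u n hn
    refine third_difference_block (64 * C) (by linarith) M hM1 (fun i => f (u + i)) ?_ n hn
    intro i
    have e : thirdDiff (fun i => f (u + i)) i = thirdDiff f (u + i) := by
      simp only [thirdDiff, add_assoc]
    rw [e]
    exact ⟨hlow.trans (hf _).1, (hf _).2.trans hupp⟩
  have hle : N ≤ (N / M ^ 3 + 1) * M ^ 3 := by
    rw [mul_comm]
    exact (Nat.lt_mul_div_succ N (pow_pos hM1 3)).le
  have h1 := norm_sum_le_of_blocks _ _ f hblock (N / M ^ 3 + 1) 0 N hle
  simp only [zero_add] at h1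
  refine h1.trans ?_
  rw [hxinv, hx2]
  have h2 : ((N / M ^ 3 + 1 : ℕ) : ℝ) ≤ N / M ^ 3 + 1 := by
    push_cast
    gcongr
    have := @Nat.cast_div_le ℝ _ _ _ N (M ^ 3)
    push_cast at this
    exact this
  have h3 : (N : ℝ) / M ≤ N * (1 / x) := by
    rw [mul_one_div]; gcongr
  have h4 : (M : ℝ) ^ 2 ≤ 4 * x ^ 2 := by
    calc (M : ℝ) ^ 2 ≤ (2 * x) ^ 2 := by gcongr
      _ = _ := by ring
  have h5 : 0 ≤ (N : ℝ) * (1 / x) := by positivity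
  calc _ ≤ ((N : ℝ) / M ^ 3 + 1) * (2 ^ 24 * (64 * C) ^ 2 * M ^ 2) := by gcongr
    _ = 2 ^ 36 * C ^ 2 * (N / M + M ^ 2) := by field_simp; ring
    _ ≤ 2 ^ 36 * C ^ 2 * (4 * (N * (1 / x) + x ^ 2)) := by gcongr; linarith
    _ = _ := by ring

theorem exists_antidifference (t : ℤ → ℝ) (c : ℝ) :
    ∃ F : ℤ → ℝ, F 0 = c ∧ ∀ n, F (n + 1) - F n = t n := by
  refine ⟨fun n => match n with
    | Int.ofNat k => c + ∑ i ∈ Finset.range k, t i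
    | Int.negSucc k => c - ∑ i ∈ Finset.range (k + 1), t (Int.negSucc i), ?_, ?_⟩
  · change c + ∑ i ∈ Finset.range 0, t i = c
    simp
  · intro n
    rcases n with k | _ | k
    · change c + ∑ i ∈ Finset.range (k + 1), t i - (c + ∑ i ∈ Finset.range k, t i) = t k
      rw [Finset.sum_range_succ]
      ring
    · change c + ∑ i ∈ Finset.range 0, t i -
        (c - ∑ i ∈ Finset.range 1, t (Int.negSucc i)) = t (Int.negSucc 0)
      simp
    · change c - ∑ i ∈ Finset.range (k + 1), t (Int.negSucc i) -
        (c - ∑ i ∈ Finset.range (k + 1 + 1), t (Int.negSucc i)) = t (Int.negSucc (k + 1))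
      rw [Finset.sum_range_succ _ (k + 1)]
      ring

theorem exists_thirdDiff_extension (f : ℤ → ℝ) (N : ℕ) (lo hi : ℝ) (hlohi : lo ≤ hi)
    (h : ∀ n : ℕ, n < N → lo ≤ thirdDiff f n ∧ thirdDiff f n ≤ hi) :
    ∃ F : ℤ → ℝ, (∀ n, lo ≤ thirdDiff F n ∧ thirdDiff F n ≤ hi) ∧
      ∀ n : ℕ, n ≤ N → F n = f n := by
  obtain ⟨F₂, h20, h2⟩ := exists_antidifference
    (fun n => if 0 ≤ n ∧ n < N then thirdDiff f n else lo) (f 2 - 2 * f 1 + f 0)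
  obtain ⟨F₁, h10, h1⟩ := exists_antidifference F₂ (f 1 - f 0)
  obtain ⟨F, h00, h0⟩ := exists_antidifference F₁ (f 0)
  refine ⟨F, ?_, ?_⟩
  · intro n
    have e : thirdDiff F n = if 0 ≤ n ∧ n < N then thirdDiff f n else lo := by
      rw [← h2 n, ← h1, ← h1, ← h0, ← h0, ← h0, thirdDiff]
      ring_nf
    rw [e]
    split_ifs with hn
    · lift n to ℕ using hn.1
      exact h n (by exact_mod_cast hn.2)
    · exact ⟨le_rfl, hlohi⟩
  · have key : ∀ n : ℕ, n ≤ N → F₂ n = f (n + 2) - 2 * f (n + 1) + f n ∧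
        F₁ n = f (n + 1) - f n ∧ F n = f n := by
      intro n
      induction n with
      | zero =>
        intro _
        simp [h20, h10, h00]
      | succ n ih =>
        intro hn
        obtain ⟨i2, i1, i0⟩ := ih (by omega)
        have e2 := h2 n
        rw [if_pos ⟨by omega, by omega⟩, thirdDiff] at e2
        have e1 := h1 n
        have e0 := h0 n
        push_cast
        rw [show (n : ℤ) + 1 + 2 = n + 3 by ring, show (n : ℤ) + 1 + 1 = n + 2 by ring]
        refine ⟨?_, ?_, ?_⟩ <;> linarith
    exact fun n hn => (key n hn).2.2

theorem third_difference_test_of_lt (C : ℝ) (hC : 1 ≤ C) (lam : ℝ) (hlam : 0 < lam) (f : ℤ → ℝ)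
    (N : ℕ) (hf : ∀ n : ℕ, n < N → lam ≤ thirdDiff f n ∧ thirdDiff f n ≤ C * lam) :
    ‖∑ n ∈ Finset.range N, e2pi (f n)‖ ≤
      2 ^ 38 * C ^ 2 * (N * lam ^ ((1 : ℝ) / 6) + lam ^ (-(1 : ℝ) / 3)) := by
  obtain ⟨F, hF, hFf⟩ := exists_thirdDiff_extension f N lam (C * lam) (by nlinarith) hf
  rw [← Finset.sum_congr rfl fun n hn => congrArg e2pi (hFf n (Finset.mem_range.1 hn).le)]
  exact third_difference_test C hC lam hlam F hF N

theorem exists_rpow_sub_eq {p x y : ℝ} (hx : 0 < x) (hxy : x < y) :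
    ∃ ξ ∈ Set.Ioo x y, y ^ p - x ^ p = (y - x) * (p * ξ ^ (p - 1)) := by
  have hd : ∀ t, 0 < t → HasDerivAt (fun t : ℝ => t ^ p) (p * t ^ (p - 1)) t :=
    fun t ht => Real.hasDerivAt_rpow_const (Or.inl ht.ne')
  obtain ⟨ξ, hξ, h⟩ := exists_hasDerivAt_eq_slope (fun t : ℝ => t ^ p)
    (fun t => p * t ^ (p - 1)) hxy
    (fun t ht => (hd t (hx.trans_le ht.1)).continuousAt.continuousWithinAt)
    fun t ht => hd t (hx.trans ht.1)
  refine ⟨ξ, hξ, ?_⟩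
  rw [h, mul_div_cancel₀ _ (by linarith : y - x ≠ 0)]

theorem exists_rpow_thirdDiff_eq (p : ℝ) {x : ℝ} (hx : 0 < x) :
    ∃ ξ ∈ Set.Ioo x (x + 3), (x + 3) ^ p - 3 * (x + 2) ^ p + 3 * (x + 1) ^ p - x ^ p =
      p * (p - 1) * (p - 2) * ξ ^ (p - 3) := by
  have hd : ∀ (r k t : ℝ), 0 < t → 0 ≤ k →
      HasDerivAt (fun t : ℝ => (t + k) ^ r) (r * (t + k) ^ (r - 1)) t := by
    intro r k t ht hk
    have := ((hasDerivAt_id t).add_const k).rpow_const (p := r) (Or.inl (by simp; linarith))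
    simpa using this
  have step : ∀ (g g' : ℝ → ℝ) (y : ℝ), 0 < y → (∀ t, 0 < t → HasDerivAt g (g' t) t) →
      ∃ ξ ∈ Set.Ioo y (y + 1), g (y + 1) - g y = g' ξ := by
    intro g g' y hy hg
    obtain ⟨ξ, hξ, h⟩ := exists_hasDerivAt_eq_slope g g' (by linarith : y < y + 1)
      (fun t ht => (hg t (hy.trans_le ht.1)).continuousAt.continuousWithinAt)
      fun t ht => hg t (hy.trans ht.1)
    exact ⟨ξ, hξ, by rw [h]; simp⟩
  obtain ⟨a, ha, ea⟩ := step
    (fun t => (t + 2) ^ p - 2 * (t + 1) ^ p + (t + 0) ^ p)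
    (fun t => p * (t + 2) ^ (p - 1) - 2 * (p * (t + 1) ^ (p - 1)) + p * (t + 0) ^ (p - 1)) x hx
    fun t ht => (((hd p 2 t ht (by norm_num)).sub
      ((hd p 1 t ht (by norm_num)).const_mul 2)).add (hd p 0 t ht le_rfl))
  have ha0 : 0 < a := hx.trans ha.1
  obtain ⟨b, hb, eb⟩ := step
    (fun t => (t + 1) ^ (p - 1) - (t + 0) ^ (p - 1))
    (fun t => (p - 1) * (t + 1) ^ (p - 1 - 1) - (p - 1) * (t + 0) ^ (p - 1 - 1)) a ha0
    fun t ht => (hd (p - 1) 1 t ht (by norm_num)).sub (hd (p - 1) 0 t ht le_rfl)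
  have hb0 : 0 < b := ha0.trans hb.1
  obtain ⟨ξ, hξ, eξ⟩ := step (fun t => (t + 0) ^ (p - 1 - 1))
    (fun t => (p - 1 - 1) * (t + 0) ^ (p - 1 - 1 - 1)) b hb0
    fun t ht => hd (p - 1 - 1) 0 t ht le_rfl
  refine ⟨ξ, ⟨by linarith [ha.1, hb.1, hξ.1], by linarith [ha.2, hb.2, hξ.2]⟩, ?_⟩
  simp only [add_zero, add_assoc] at ea eb eξ
  norm_num at ea eb eξ
  rw [show p - 1 - 1 - 1 = p - 3 by ring, show p - 1 - 1 = p - 2 by ring] at eξ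
  rw [show p - 1 - 1 = p - 2 by ring] at eb
  linear_combination ea + p * eb + p * (p - 1) * eξ

theorem sum_Ioc_int_eq_sum_range {E : Type*} [AddCommMonoid E] (F : ℤ → E) (a b : ℤ) :
    ∑ d ∈ Finset.Ioc a b, F d = ∑ n ∈ Finset.range (b - a).toNat, F (a + 1 + n) := by
  refine Finset.sum_nbij' (fun d => (d - a - 1).toNat) (fun n => a + 1 + n) ?_ ?_ ?_ ?_ ?_
  · intro d hd
    have := Finset.mem_Ioc.1 hd
    exact Finset.mem_range.2 (by omega)
  · intro n hn
    have := Finset.mem_range.1 hn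
    exact Finset.mem_Ioc.2 (by omega)
  · intro d hd
    have := Finset.mem_Ioc.1 hd
    omega
  · intro n _
    omega
  · intro d hd
    have := Finset.mem_Ioc.1 hd
    congr 1
    omega

theorem norm_sum_quadratic_sub_rpow_le {γ : ℝ} (hγ1 : 0 < γ) (hγ2 : γ < 1) (R P lam C D : ℝ)
    (hC : 1 ≤ C) (hlam : 0 < lam) (hP : 0 ≤ P) (hD : 1 ≤ D)
    (hlow : lam ≤ P * (γ * (γ - 1) * (γ - 2) * (5 * D) ^ (γ - 3)))
    (hupp : P * (γ * (γ - 1) * (γ - 2) * D ^ (γ - 3)) ≤ C * lam) (D₁ D₂ : ℝ) (h1 : D ≤ D₁)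
    (h12 : D₁ ≤ D₂) (h2 : D₂ ≤ 2 * D) :
    ‖∑ d ∈ Finset.Ioc ⌊D₁⌋ ⌊D₂⌋, e2pi (R * (d : ℝ) ^ 2 - P * (d : ℝ) ^ γ)‖ ≤
      2 ^ 39 * C ^ 2 * (D * lam ^ ((1 : ℝ) / 6) + lam ^ (-(1 : ℝ) / 3)) := by
  rw [sum_Ioc_int_eq_sum_range, ← norm_sum_e2pi_neg]
  set N := (⌊D₂⌋ - ⌊D₁⌋).toNat with hN
  have hfl1 := Int.lt_floor_add_one D₁
  have hfl2 := Int.floor_le D₂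
  have hfl : ⌊D₁⌋ ≤ ⌊D₂⌋ := Int.floor_le_floor h12
  have hND : (N : ℝ) ≤ 2 * D := by
    have : ((N : ℤ) : ℝ) = ⌊D₂⌋ - ⌊D₁⌋ := by
      rw [hN, Int.toNat_of_nonneg (by omega)]; push_cast; rfl
    rw [Int.cast_natCast] at this
    linarith
  have hg : 0 < γ * (γ - 1) * (γ - 2) := by nlinarith [mul_pos hγ1 (sub_pos.2 hγ2)]
  have hmain := third_difference_test_of_lt C hC lam hlam
    (fun n => -(R * ((⌊D₁⌋ + 1 + n : ℤ) : ℝ) ^ 2 - P * ((⌊D₁⌋ + 1 + n : ℤ) : ℝ) ^ γ)) N ?_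
  · refine hmain.trans ?_
    have e0 : 0 ≤ lam ^ (-(1 : ℝ) / 3) := by positivity
    calc 2 ^ 38 * C ^ 2 * (N * lam ^ ((1 : ℝ) / 6) + lam ^ (-(1 : ℝ) / 3)) ≤
        2 ^ 38 * C ^ 2 * (2 * D * lam ^ ((1 : ℝ) / 6) + 2 * lam ^ (-(1 : ℝ) / 3)) := by
          gcongr; linarith
      _ = _ := by ring
  · intro n hn
    obtain ⟨x, hx⟩ : ∃ x : ℝ, x = ⌊D₁⌋ + 1 + n := ⟨_, rfl⟩
    have hxD : D ≤ x := by rw [hx]; linarith [Nat.cast_nonneg (α := ℝ) n]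
    have hx2 : x ≤ 2 * D := by
      have : ((⌊D₁⌋ + 1 + n : ℤ) : ℝ) ≤ ⌊D₂⌋ := by exact_mod_cast (by omega)
      push_cast at this
      linarith
    obtain ⟨ξ, hξ, e⟩ := exists_rpow_thirdDiff_eq γ (by linarith : 0 < x)
    have e3 : thirdDiff (fun n => -(R * ((⌊D₁⌋ + 1 + n : ℤ) : ℝ) ^ 2 -
        P * ((⌊D₁⌋ + 1 + n : ℤ) : ℝ) ^ γ)) n = P * (γ * (γ - 1) * (γ - 2) * ξ ^ (γ - 3)) := by
      rw [← e, hx, thirdDiff]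
      push_cast
      simp only [← add_assoc]
      ring
    have hξ0 : 0 < ξ := by linarith [hξ.1]
    rw [e3]
    constructor
    · refine hlow.trans ?_
      have := Real.rpow_le_rpow_of_nonpos hξ0 (by linarith [hξ.2] : ξ ≤ 5 * D)
        (by linarith : γ - 3 ≤ 0)
      gcongr
    · refine le_trans ?_ hupp
      have := Real.rpow_le_rpow_of_nonpos (by linarith : 0 < D) (by linarith [hξ.1] : D ≤ ξ)
        (by linarith : γ - 3 ≤ 0)
      gcongr

theorem rpow_differenced_size (m q D L γ s : ℝ) (hm : 0 ≤ m) (hq : 0 ≤ q) (hD : 0 < D)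
    (hL : 0 < L) :
    (m * q * D ^ (γ - 3) * L ^ (γ - 1)) ^ s =
      m ^ s * q ^ s * D ^ ((γ - 3) * s) * L ^ ((γ - 1) * s) := by
  rw [Real.mul_rpow (by positivity) (by positivity), Real.mul_rpow (by positivity) (by positivity),
    Real.mul_rpow hm hq, Real.rpow_mul hD.le, Real.rpow_mul hL.le]

theorem differenced_exp_sum_bound (γ : ℝ) (hγ1 : 0 < γ) (hγ2 : γ < 1) :
    ∃ C > 0, ∀ (α : ℝ) (h m q' : ℕ) (l : ℤ) (D L D₁ D₂ : ℝ),
      0 < h → 0 < m → 0 < q' → 1 ≤ D → 1 ≤ L →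
      L < (l : ℝ) → (l : ℝ) + (q' : ℝ) ≤ 2 * L →
      D ≤ D₁ → D₁ ≤ D₂ → D₂ ≤ 2 * D →
      ‖∑ d ∈ Finset.Ioc ⌊D₁⌋ ⌊D₂⌋,
          e2pi ((α * (h : ℝ) * (d : ℝ) ^ 2 * ((l : ℝ) + (q' : ℝ)) ^ 2 -
              (m : ℝ) * (d : ℝ) ^ γ * ((l : ℝ) + (q' : ℝ)) ^ γ) -
            (α * (h : ℝ) * (d : ℝ) ^ 2 * (l : ℝ) ^ 2 -
              (m : ℝ) * (d : ℝ) ^ γ * (l : ℝ) ^ γ))‖ ≤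
      C * ((m : ℝ) ^ ((1 : ℝ) / 6) * (q' : ℝ) ^ ((1 : ℝ) / 6) *
          D ^ (γ / 6 + 1 / 2) * L ^ (γ / 6 - 1 / 6) +
        (m : ℝ) ^ (-(1 : ℝ) / 3) * (q' : ℝ) ^ (-(1 : ℝ) / 3) *
          D ^ (1 - γ / 3) * L ^ (1 / 3 - γ / 3)) := by
  set g : ℝ := γ * (γ - 1) * (γ - 2) with hg
  have hg0 : 0 < g := by rw [hg]; nlinarith [mul_pos hγ1 (sub_pos.2 hγ2)]
  set b : ℝ := 5 ^ (γ - 3) * 2 ^ (γ - 1) with hb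
  have hb0 : 0 < b := by rw [hb]; positivity
  have hb1 : b ≤ 1 := by
    have h1 : (5 : ℝ) ^ (γ - 3) ≤ 1 :=
      Real.rpow_le_one_of_one_le_of_nonpos (by norm_num) (by linarith)
    have h2 : (2 : ℝ) ^ (γ - 1) ≤ 1 :=
      Real.rpow_le_one_of_one_le_of_nonpos (by norm_num) (by linarith)
    exact mul_le_one₀ h1 (by positivity) h2
  set a : ℝ := γ * g * b with ha
  have ha0 : 0 < a := by positivity
  refine ⟨2 ^ 39 * (1 / b) ^ 2 * (a ^ ((1 : ℝ) / 6) + a ^ (-(1 : ℝ) / 3)), by positivity, ?_⟩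
  intro α h m q' l D L D₁ D₂ _ hm hq hD hL hl hlq h1 h12 h2
  have hm0 : (0 : ℝ) < m := by exact_mod_cast hm
  have hq0 : (0 : ℝ) < q' := by exact_mod_cast hq
  have hD0 : 0 < D := by linarith
  have hL0 : 0 < L := by linarith
  obtain ⟨η, hη, eη⟩ := exists_rpow_sub_eq (p := γ) (hL0.trans hl)
    (by linarith : (l : ℝ) < l + q')
  rw [add_sub_cancel_left] at eη
  have hη0 : 0 < η := by linarith [hη.1]
  set lam : ℝ := m * q' * D ^ (γ - 3) * L ^ (γ - 1) with hlam
  have hlam0 : 0 < lam := by positivity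
  set P : ℝ := m * (q' * (γ * η ^ (γ - 1))) with hP
  have hηup : η ^ (γ - 1) ≤ L ^ (γ - 1) :=
    Real.rpow_le_rpow_of_nonpos hL0 (by linarith [hη.1]) (by linarith)
  have hηlow : 2 ^ (γ - 1) * L ^ (γ - 1) ≤ η ^ (γ - 1) := by
    rw [← Real.mul_rpow (by norm_num) hL0.le]
    exact Real.rpow_le_rpow_of_nonpos hη0 (by linarith [hη.2]) (by linarith)
  have hmain := norm_sum_quadratic_sub_rpow_le hγ1 hγ2 (α * h * ((l + q') ^ 2 - (l : ℝ) ^ 2)) P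
    (a * lam) (1 / b) D (by rw [le_div_iff₀ hb0]; linarith) (by positivity) (by positivity) hD
    ?_ ?_ D₁ D₂ h1 h12 h2
  · have e : ∀ d : ℤ, (α * (h : ℝ) * (d : ℝ) ^ 2 * ((l : ℝ) + (q' : ℝ)) ^ 2 -
        (m : ℝ) * (d : ℝ) ^ γ * ((l : ℝ) + (q' : ℝ)) ^ γ) -
        (α * (h : ℝ) * (d : ℝ) ^ 2 * (l : ℝ) ^ 2 - (m : ℝ) * (d : ℝ) ^ γ * (l : ℝ) ^ γ) =
        α * h * ((l + q') ^ 2 - (l : ℝ) ^ 2) * (d : ℝ) ^ 2 - P * (d : ℝ) ^ γ := by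
      intro d
      rw [hP, ← eη]
      ring
    simp only [e]
    refine hmain.trans ?_
    rw [mul_assoc (2 ^ 39 * (1 / b) ^ 2)]
    refine mul_le_mul_of_nonneg_left ?_ (by positivity)
    have s1 : D * lam ^ ((1 : ℝ) / 6) = (m : ℝ) ^ ((1 : ℝ) / 6) * (q' : ℝ) ^ ((1 : ℝ) / 6) *
        D ^ (γ / 6 + 1 / 2) * L ^ (γ / 6 - 1 / 6) := by
      rw [hlam, rpow_differenced_size _ _ _ _ _ _ hm0.le hq0.le hD0 hL0,
        show γ / 6 + 1 / 2 = 1 + (γ - 3) * (1 / 6) by ring, Real.rpow_one_add' hD0.le (by linarith),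
        show γ / 6 - 1 / 6 = (γ - 1) * (1 / 6) by ring]
      ring
    have s2 : lam ^ (-(1 : ℝ) / 3) = (m : ℝ) ^ (-(1 : ℝ) / 3) * (q' : ℝ) ^ (-(1 : ℝ) / 3) *
        D ^ (1 - γ / 3) * L ^ (1 / 3 - γ / 3) := by
      rw [hlam, rpow_differenced_size _ _ _ _ _ _ hm0.le hq0.le hD0 hL0,
        show 1 - γ / 3 = (γ - 3) * (-1 / 3) by ring, show 1 / 3 - γ / 3 = (γ - 1) * (-1 / 3) by ring]
    rw [← s1, ← s2, Real.mul_rpow ha0.le hlam0.le, Real.mul_rpow ha0.le hlam0.le]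
    have p1 : 0 ≤ a ^ ((1 : ℝ) / 6) * lam ^ (-(1 : ℝ) / 3) := by positivity
    have p2 : 0 ≤ a ^ (-(1 : ℝ) / 3) * (D * lam ^ ((1 : ℝ) / 6)) := by positivity
    linarith
  · rw [Real.mul_rpow (by norm_num) hD0.le]
    calc a * lam = m * (q' * (γ * (2 ^ (γ - 1) * L ^ (γ - 1)))) *
          (g * (5 ^ (γ - 3) * D ^ (γ - 3))) := by rw [ha, hb, hlam]; ring
      _ ≤ _ := by rw [hP]; gcongr
  · calc P * (g * D ^ (γ - 3)) ≤ m * (q' * (γ * L ^ (γ - 1))) * (g * D ^ (γ - 3)) := by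
          rw [hP]; gcongr
      _ = 1 / b * (a * lam) := by rw [ha, hlam]; field_simp
end

section
/- Let 13/14 < γ < 1 be fixed and ε > 0. Suppose α and β are real and a, q are integers with q ≥ 2, gcd(a,q) = 1 and |α − a/q| < 1/q². Set N = q^{29/(55−28γ)}, H = ⌊q^{1/2}⌋ and let Δ be any real number. Then Ω = Σ_{n=1}^{N} ( min(1, 1/(H‖αn² + β + Δ‖)) + min(1, 1/(H‖αn² + β − Δ‖)) ) satisfies Ω ≪ N^{(28γ+3)/58 + ε}, where the implied constant depends only on γ and ε. -/
/-- `nint x` is the distance from the real number `x` to the nearest integer. -/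
noncomputable def nint (x : ℝ) : ℝ := |x - round x|

theorem exists_card_divisors_le_rpow {η : ℝ} (hη : 0 < η) :
    ∃ C : ℝ, 1 ≤ C ∧ ∀ n : ℕ, n ≠ 0 → (n.divisors.card : ℝ) ≤ C * (n : ℝ) ^ η := by
  set A : ℝ := max 1 (1 / (η * Real.log 2)) with hA
  set P : ℕ := ⌈(2 : ℝ) ^ (1 / η)⌉₊ with hP
  have hA1 : 1 ≤ A := le_max_left _ _
  have hl2 : 0 < Real.log 2 := Real.log_pos (by norm_num)
  refine ⟨A ^ P, one_le_pow₀ hA1, fun n hn => ?_⟩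
  have key : ∀ p ∈ n.primeFactors, ((n.factorization p + 1 : ℕ) : ℝ) ≤
      (if p < P then A else 1) * ((p : ℝ) ^ η) ^ (n.factorization p) := by
    intro p hp
    have hp2 : (2 : ℝ) ≤ p := by exact_mod_cast (Nat.prime_of_mem_primeFactors hp).two_le
    set k := n.factorization p
    split_ifs with h
    · have h1 : 1 + k * (η * Real.log 2) ≤ ((p : ℝ) ^ η) ^ k := by
        calc 1 + k * (η * Real.log 2) = k * (η * Real.log 2) + 1 := by ring
          _ ≤ Real.exp (k * (η * Real.log 2)) := Real.add_one_le_exp _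
          _ = ((2 : ℝ) ^ η) ^ k := by
              rw [Real.exp_nat_mul, Real.rpow_def_of_pos (by norm_num), mul_comm η]
          _ ≤ _ := by gcongr
      have h2 : 1 ≤ A * (η * Real.log 2) := by
        have : 1 / (η * Real.log 2) ≤ A := le_max_right _ _
        rwa [div_le_iff₀ (by positivity)] at this
      calc ((k + 1 : ℕ) : ℝ) = 1 + k * 1 := by push_cast; ring
        _ ≤ A + k * (A * (η * Real.log 2)) := by gcongr
        _ = A * (1 + k * (η * Real.log 2)) := by ring
        _ ≤ _ := by gcongr
    · have h3 : (2 : ℝ) ≤ (p : ℝ) ^ η := by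
        have : (2 : ℝ) ^ (1 / η) ≤ p := (Nat.le_ceil _).trans (by exact_mod_cast not_lt.1 h)
        calc (2 : ℝ) = ((2 : ℝ) ^ (1 / η)) ^ η := by
              rw [← Real.rpow_mul (by norm_num), one_div_mul_cancel hη.ne', Real.rpow_one]
          _ ≤ _ := by gcongr
      calc ((k + 1 : ℕ) : ℝ) ≤ (2 : ℝ) ^ k := by exact_mod_cast Nat.lt_two_pow_self
        _ ≤ 1 * ((p : ℝ) ^ η) ^ k := by rw [one_mul]; gcongr
  calc (n.divisors.card : ℝ) = ∏ p ∈ n.primeFactors, ((n.factorization p + 1 : ℕ) : ℝ) := by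
        rw [Nat.card_divisors hn, Nat.cast_prod]
    _ ≤ ∏ p ∈ n.primeFactors,
        ((if p < P then A else 1) * ((p : ℝ) ^ η) ^ (n.factorization p)) :=
        Finset.prod_le_prod (fun _ _ => by positivity) key
    _ = (∏ p ∈ n.primeFactors, (if p < P then A else 1)) * (n : ℝ) ^ η := by
        rw [Finset.prod_mul_distrib]
        congr 1
        conv_rhs => rw [← Nat.prod_factorization_pow_eq_self hn]
        rw [Finsupp.prod, Nat.support_factorization, Nat.cast_prod,
          ← Real.finsetProd_rpow _ _ (fun _ _ => by positivity)]
        refine Finset.prod_congr rfl fun p _ => ?_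
        rw [Nat.cast_pow, ← Real.rpow_natCast, ← Real.rpow_natCast, ← Real.rpow_mul (by positivity),
          ← Real.rpow_mul (by positivity), mul_comm]
    _ ≤ A ^ P * (n : ℝ) ^ η := by
        gcongr
        rw [Finset.prod_ite, Finset.prod_const, Finset.prod_const_one, mul_one]
        refine pow_le_pow_right₀ hA1 ?_
        calc _ ≤ (Finset.range P).card := Finset.card_le_card fun p hp => by simp_all
          _ = P := Finset.card_range P

open ComplexConjugate in
theorem normSq_sum_range_succ (z : ℕ → ℂ) (n : ℕ) :
    ‖∑ k ∈ Finset.range (n + 1), z k‖ ^ 2 = ∑ k ∈ Finset.range (n + 1), ‖z k‖ ^ 2 +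
      2 * (∑ d ∈ Finset.range n, ∑ k ∈ Finset.range (n - d), z (k + d + 1) * conj (z k)).re := by
  rw [← Finset.sum_range_diag_flip n (fun d k => z (k + d + 1) * conj (z k))]
  induction n with
  | zero => simp
  | succ n ih =>
    rw [Finset.sum_range_succ, Finset.sum_range_succ (fun k => ‖z k‖ ^ 2) (n + 1),
      Finset.sum_range_succ
        (fun m => ∑ k ∈ Finset.range (m + 1), z (m - k + k + 1) * conj (z (m - k))) n]
    have h1 : ∑ k ∈ Finset.range (n + 1), z (n - k + k + 1) * conj (z (n - k)) =
        z (n + 1) * conj (∑ k ∈ Finset.range (n + 1), z k) := by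
      rw [← Finset.sum_range_reflect, map_sum, Finset.mul_sum]
      refine Finset.sum_congr rfl fun k hk => ?_
      have := Finset.mem_range.1 hk
      rw [show n - (n + 1 - 1 - k) = k by omega, show k + (n + 1 - 1 - k) + 1 = n + 1 by omega]
    rw [h1, Complex.add_re, mul_add, ← add_assoc, add_right_comm _ (‖z (n+1)‖ ^ 2), ← ih]
    simp only [← Complex.normSq_eq_norm_sq, Complex.normSq_add]
    rw [← Complex.conj_re (z (n + 1) * _), map_mul, Complex.conj_conj, mul_comm (conj _)]

theorem nint_nonneg (x : ℝ) : 0 ≤ nint x := abs_nonneg _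

theorem nint_le_nint_add_abs (x y : ℝ) (k : ℤ) : nint x ≤ nint y + |x - k - y| := by
  calc nint x ≤ |x - ((round y + k : ℤ) : ℝ)| := round_le x _
    _ = |(y - round y) + (x - k - y)| := by push_cast; congr 1; ring
    _ ≤ _ := abs_add_le _ _

/-- The additive character `x ↦ exp (2 * π * i * x)`. -/
noncomputable def expTwoPi (x : ℝ) : ℂ := Complex.exp (Complex.I * ((2 * Real.pi * x : ℝ) : ℂ))

theorem norm_expTwoPi (x : ℝ) : ‖expTwoPi x‖ = 1 := Complex.norm_exp_I_mul_ofReal _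

theorem expTwoPi_add (x y : ℝ) : expTwoPi (x + y) = expTwoPi x * expTwoPi y := by
  rw [expTwoPi, expTwoPi, expTwoPi, ← Complex.exp_add]
  push_cast
  ring_nf

theorem expTwoPi_natCast_mul (k : ℕ) (x : ℝ) : expTwoPi (k * x) = expTwoPi x ^ k := by
  rw [expTwoPi, expTwoPi, ← Complex.exp_nat_mul]
  push_cast
  ring_nf

theorem expTwoPi_mul_conj (x y : ℝ) :
    expTwoPi x * (starRingEnd ℂ) (expTwoPi y) = expTwoPi (x - y) := by
  have : (starRingEnd ℂ) (expTwoPi y) = expTwoPi (-y) := by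
    rw [expTwoPi, expTwoPi, ← Complex.exp_conj, map_mul, Complex.conj_I, Complex.conj_ofReal]
    push_cast
    ring_nf
  rw [this, ← expTwoPi_add, sub_eq_add_neg]

theorem expTwoPi_sub_intCast (x : ℝ) (k : ℤ) : expTwoPi (x - k) = expTwoPi x := by
  rw [expTwoPi, expTwoPi, Complex.exp_eq_exp_iff_exists_int]
  exact ⟨-k, by push_cast; ring⟩

theorem four_mul_nint_le (x : ℝ) : 4 * nint x ≤ ‖expTwoPi x - 1‖ := by
  rw [← expTwoPi_sub_intCast x (round x), expTwoPi, Complex.norm_exp_I_mul_ofReal_sub_one]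
  have h := abs_sub_round x
  unfold nint
  set y := x - round x
  have h1 := Real.mul_le_sin (x := Real.pi * |y|) (by positivity) (by nlinarith [Real.pi_pos])
  rw [← mul_assoc, div_mul_cancel₀ _ Real.pi_ne_zero] at h1
  have h2 : Real.sin (Real.pi * |y|) ≤ |Real.sin (Real.pi * y)| := by
    rcases abs_choice y with h' | h' <;> rw [h']
    · exact le_abs_self _
    · rw [mul_neg, Real.sin_neg]; exact neg_le_abs _
  rw [norm_mul, Real.norm_eq_abs, Real.norm_eq_abs, abs_two,
    show 2 * Real.pi * y / 2 = Real.pi * y by ring]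
  linarith

/-- A smooth substitute for `min N (1 / nint x)`. -/
noncomputable def cutoff (N x : ℝ) : ℝ := N / (1 + N * nint x)

theorem one_add_mul_nint_pos {N : ℝ} (hN : 0 ≤ N) (x : ℝ) : 0 < 1 + N * nint x := by
  have := nint_nonneg x
  positivity

theorem cutoff_nonneg {N : ℝ} (hN : 0 ≤ N) (x : ℝ) : 0 ≤ cutoff N x :=
  div_nonneg hN (one_add_mul_nint_pos hN x).le

theorem norm_geom_sum_expTwoPi_le {L N : ℕ} (hLN : L ≤ N) (x : ℝ) :
    ‖∑ k ∈ Finset.range L, expTwoPi x ^ k‖ ≤ 2 * cutoff N x := by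
  have h1 : ‖∑ k ∈ Finset.range L, expTwoPi x ^ k‖ ≤ N := by
    refine (norm_sum_le _ _).trans ?_
    simp only [norm_pow, norm_expTwoPi, one_pow, Finset.sum_const, Finset.card_range, nsmul_eq_mul,
      mul_one]
    exact_mod_cast hLN
  have h2 : ‖∑ k ∈ Finset.range L, expTwoPi x ^ k‖ * (4 * nint x) ≤ 2 := by
    calc _ ≤ ‖∑ k ∈ Finset.range L, expTwoPi x ^ k‖ * ‖expTwoPi x - 1‖ := by
          gcongr; exact four_mul_nint_le x
      _ = ‖expTwoPi x ^ L - 1‖ := by rw [← norm_mul, geom_sum_mul]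
      _ ≤ ‖expTwoPi x ^ L‖ + ‖(1 : ℂ)‖ := norm_sub_le _ _
      _ = 2 := by rw [norm_pow, norm_expTwoPi]; norm_num
  rw [cutoff, ← mul_div_assoc, le_div_iff₀ (one_add_mul_nint_pos N.cast_nonneg x)]
  nlinarith [(N.cast_nonneg : (0 : ℝ) ≤ N)]

theorem half_le_norm_geom_sum_expTwoPi {K : ℕ} {x : ℝ} (h : K * nint x ≤ 1 / 8) :
    (K : ℝ) / 2 ≤ ‖∑ k ∈ Finset.range K, expTwoPi x ^ k‖ := by
  refine le_trans ?_ (Complex.re_le_norm _)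
  rw [Complex.re_sum]
  have : ∀ k ∈ Finset.range K, (1 / 2 : ℝ) ≤ (expTwoPi x ^ k).re := by
    intro k hk
    have hk' : (k : ℝ) ≤ K := by exact_mod_cast (Finset.mem_range.1 hk).le
    rw [← expTwoPi_sub_intCast x (round x), ← expTwoPi_natCast_mul, expTwoPi, mul_comm,
      Complex.exp_ofReal_mul_I_re]
    have h1 : |(k : ℝ) * (x - round x)| ≤ 1 / 8 := by
      rw [abs_mul, Nat.abs_cast]
      exact (mul_le_mul_of_nonneg_right hk' (abs_nonneg _)).trans h
    have h2 : |2 * Real.pi * (k * (x - round x))| ≤ 1 := by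
      rw [abs_mul, abs_of_pos (by positivity)]
      nlinarith [Real.pi_lt_four, Real.pi_pos]
    have h3 := Real.one_sub_sq_div_two_le_cos (x := 2 * Real.pi * (k * (x - round x)))
    have h4 := (sq_le_one_iff_abs_le_one _).2 h2
    linarith
  calc (K : ℝ) / 2 = ∑ k ∈ Finset.range K, (1 / 2 : ℝ) := by simp; ring
    _ ≤ _ := Finset.sum_le_sum this

theorem one_div_one_add_le_fejer {H : ℕ} (hH : 1 ≤ H) (x : ℝ) :
    1 / (1 + H * nint x) ≤ 64 / H * ∑ K ∈ Finset.Icc 1 H,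
      ‖∑ k ∈ Finset.range K, expTwoPi x ^ k‖ ^ 2 / (K : ℝ) ^ 2 := by
  have ht := nint_nonneg x
  have hHpos : (0 : ℝ) < H := by exact_mod_cast hH
  have hpos := one_add_mul_nint_pos hHpos.le x
  set y : ℝ := H / (8 * (1 + H * nint x)) with hy
  have hy0 : 0 ≤ y := by positivity
  set J : ℕ := max 1 ⌊y⌋₊ with hJ
  have hyH : y ≤ H := div_le_self hHpos.le (by nlinarith [mul_nonneg hHpos.le ht])
  have hJH : J ≤ H := max_le hH (Nat.floor_le_of_le hyH)
  have hJy : y ≤ 2 * J := by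
    have h1 := Nat.lt_floor_add_one y
    have h2 : (1 : ℝ) ≤ J := by exact_mod_cast le_max_left _ _
    have h3 : ((⌊y⌋₊ : ℕ) : ℝ) ≤ J := by exact_mod_cast le_max_right _ _
    linarith
  have hterm : ∀ K ∈ Finset.Icc 1 J,
      (1 / 4 : ℝ) ≤ ‖∑ k ∈ Finset.range K, expTwoPi x ^ k‖ ^ 2 / (K : ℝ) ^ 2 := by
    intro K hK
    obtain ⟨hK1, hKJ⟩ := Finset.mem_Icc.1 hK
    have hKpos : (0 : ℝ) < K := by exact_mod_cast hK1
    have h : (K : ℝ) / 2 ≤ ‖∑ k ∈ Finset.range K, expTwoPi x ^ k‖ := by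
      rcases le_max_iff.1 hKJ with h | h
      · obtain rfl : K = 1 := le_antisymm h hK1
        norm_num
      · apply half_le_norm_geom_sum_expTwoPi
        have hKy : (K : ℝ) ≤ y := (Nat.cast_le.2 h).trans (Nat.floor_le hy0)
        calc K * nint x ≤ y * nint x := by gcongr
          _ ≤ 1 / 8 := by
            rw [hy, div_mul_eq_mul_div, div_le_div_iff₀ (by positivity) (by norm_num)]
            linarith
    rw [le_div_iff₀ (by positivity)]
    nlinarith
  have hsum : (J : ℝ) / 4 ≤ ∑ K ∈ Finset.Icc 1 H,
      ‖∑ k ∈ Finset.range K, expTwoPi x ^ k‖ ^ 2 / (K : ℝ) ^ 2 := by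
    calc (J : ℝ) / 4 = ∑ K ∈ Finset.Icc 1 J, (1 / 4 : ℝ) := by simp; ring
      _ ≤ ∑ K ∈ Finset.Icc 1 J, ‖∑ k ∈ Finset.range K, expTwoPi x ^ k‖ ^ 2 / (K : ℝ) ^ 2 :=
          Finset.sum_le_sum hterm
      _ ≤ _ := Finset.sum_le_sum_of_subset_of_nonneg (Finset.Icc_subset_Icc_right hJH)
          fun _ _ _ => by positivity
  calc 1 / (1 + H * nint x) = 64 / H * (y / 8) := by rw [hy]; field_simp; norm_num
    _ ≤ _ := by gcongr; linarith

theorem sum_Icc_one_eq_sum_range {M : Type*} [AddCommMonoid M] (f : ℕ → M) (n : ℕ) :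
    ∑ k ∈ Finset.Icc 1 n, f k = ∑ k ∈ Finset.range n, f (k + 1) := by
  induction n with
  | zero => simp
  | succ n ih => rw [Finset.sum_Icc_succ_top (by omega), ih, Finset.sum_range_succ]

theorem cutoff_le_of_abs_sub_le {q N r : ℕ} (hrq : r < q) (hqN : q ≤ N) {x : ℝ} (k : ℤ)
    (h : |x - k - (r : ℝ) / q| ≤ 2 / q) :
    cutoff N x ≤ 4 * N * (1 / ((r : ℝ) + 1) + 1 / ((q : ℝ) - r)) := by
  have hq : (0 : ℝ) < q := by exact_mod_cast (Nat.zero_le r).trans_lt hrq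
  have hr : (r : ℝ) + 1 ≤ q := by exact_mod_cast hrq
  have hqN' : (q : ℝ) ≤ N := by exact_mod_cast hqN
  have ht := nint_nonneg x
  set s : ℝ := min (r : ℝ) (q - r) with hs
  have hs0 : 0 ≤ s := le_min r.cast_nonneg (by linarith)
  have h1 : nint ((r : ℝ) / q) = s / q := by
    rw [nint, abs_sub_round_div_natCast_eq, Nat.mod_eq_of_lt hrq, Nat.cast_min,
      Nat.cast_sub hrq.le]
  have h2 := nint_le_nint_add_abs ((r : ℝ) / q) x (-k)
  rw [h1, show (r : ℝ) / q - ((-k : ℤ) : ℝ) - x = -(x - k - (r : ℝ) / q) by push_cast; ring,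
    abs_neg] at h2
  have h3 : s - 2 ≤ q * nint x := by
    have : s / q - 2 / q ≤ nint x := by linarith
    rw [← sub_div, div_le_iff₀ hq] at this
    linarith
  have h4 : q * nint x ≤ N * nint x := by gcongr
  have h5 : 0 ≤ (q : ℝ) * nint x := by positivity
  calc cutoff N x ≤ 4 * N * (1 / (s + 1)) := by
        rw [cutoff, mul_one_div, div_le_div_iff₀ (by linarith) (by linarith)]
        nlinarith [(N.cast_nonneg : (0 : ℝ) ≤ N)]
    _ ≤ _ := by
        gcongr
        have p1 : 0 < 1 / ((r : ℝ) + 1) := by positivity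
        have p2 : 0 < 1 / ((q : ℝ) - r) := one_div_pos.2 (by linarith)
        rcases min_choice (r : ℝ) (q - r) with h' | h' <;> rw [hs, h']
        · linarith
        · have : 1 / ((q : ℝ) - r + 1) ≤ 1 / ((q : ℝ) - r) :=
            one_div_le_one_div_of_le (by linarith) (by linarith)
          linarith

theorem sum_cutoff_block_le {α : ℝ} {a : ℤ} {q N : ℕ} (hq : 1 ≤ q) (hqN : q ≤ N)
    (hcop : Int.gcd a q = 1) (hα : |α - a / q| ≤ 1 / (q : ℝ) ^ 2) (m : ℕ) :
    ∑ j ∈ Finset.range q, cutoff N (α * ((m + j : ℕ) : ℝ)) ≤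
      8 * N * ∑ r ∈ Finset.range q, 1 / ((r : ℝ) + 1) := by
  have hq0 : (0 : ℝ) < q := by exact_mod_cast hq
  have hqz : (0 : ℤ) < q := by exact_mod_cast hq
  set c : ℤ := ⌊q * (α * m)⌋ with hc
  set ρ : ℕ → ℕ := fun j => ((a * j + c) % q).toNat with hρ
  have hρz : ∀ j, ((ρ j : ℕ) : ℤ) = (a * j + c) % q := fun j =>
    Int.toNat_of_nonneg (Int.emod_nonneg _ hqz.ne')
  have hρlt : ∀ j, ρ j < q := fun j => by
    have := Int.emod_lt_of_pos (a * j + c) hqz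
    rw [← hρz] at this
    exact_mod_cast this
  have hinj : Set.InjOn ρ (Finset.range q) := by
    intro i hi j hj hij
    have h1 : (a * i + c) % (q : ℤ) = (a * j + c) % q := by rw [← hρz, ← hρz, hij]
    have h2 : (q : ℤ) ∣ a * (j - i) := by
      have := Int.ModEq.dvd h1
      rwa [add_sub_add_right_eq_sub, ← mul_sub] at this
    have h3 : (q : ℤ) ∣ (j - i : ℤ) :=
      (Int.isCoprime_iff_gcd_eq_one.2 (by rwa [Int.gcd_comm])).dvd_of_dvd_mul_left h2
    have h4 : (i : ℤ) ≡ j [ZMOD q] := (Int.modEq_iff_dvd).2 h3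
    exact ((Int.natCast_modEq_iff).1 h4).eq_of_lt_of_lt (Finset.mem_range.1 hi)
      (Finset.mem_range.1 hj)
  have hterm : ∀ j ∈ Finset.range q, cutoff N (α * ((m + j : ℕ) : ℝ)) ≤
      4 * N * (1 / ((ρ j : ℝ) + 1) + 1 / ((q : ℝ) - ρ j)) := by
    intro j hj
    have hjq : (j : ℝ) ≤ q := by exact_mod_cast (Finset.mem_range.1 hj).le
    refine cutoff_le_of_abs_sub_le (hρlt j) hqN ((a * j + c) / q) ?_
    have h1 : (((a * j + c) / q : ℤ) : ℝ) + (ρ j : ℝ) / q = (a * j + c) / q := by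
      have h := Int.emod_add_mul_ediv (a * j + c) q
      rw [← hρz] at h
      have h' : (ρ j : ℝ) + q * (((a * j + c) / q : ℤ) : ℝ) = a * j + c := by exact_mod_cast h
      rw [← h']
      field_simp
      ring
    have h2 : α * ((m + j : ℕ) : ℝ) - (((a * j + c) / q : ℤ) : ℝ) - (ρ j : ℝ) / q =
        (q * (α * m) - c) / q + (α - a / q) * j := by
      rw [sub_sub, h1]
      push_cast
      field_simp
      ring
    rw [h2]
    have h3 : |(q * (α * m) - c) / q| ≤ 1 / (q : ℝ) := by
      rw [abs_div, abs_of_pos hq0]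
      gcongr
      rw [hc, ← Int.fract, abs_of_nonneg (Int.fract_nonneg _)]
      exact (Int.fract_lt_one _).le
    have h4 : |(α - a / q) * j| ≤ 1 / (q : ℝ) := by
      rw [abs_mul, Nat.abs_cast]
      calc _ ≤ 1 / (q : ℝ) ^ 2 * q := by gcongr
        _ = 1 / (q : ℝ) := by field_simp
    calc _ ≤ 1 / (q : ℝ) + 1 / (q : ℝ) := (abs_add_le _ _).trans (add_le_add h3 h4)
      _ = 2 / q := by ring
  have hnn : ∀ r ∈ Finset.range q, 0 ≤ 4 * N * (1 / ((r : ℝ) + 1) + 1 / ((q : ℝ) - r)) := by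
    intro r hr
    have : (r : ℝ) ≤ q := by exact_mod_cast (Finset.mem_range.1 hr).le
    have := sub_nonneg.2 this
    positivity
  calc _ ≤ ∑ j ∈ Finset.range q, 4 * N * (1 / ((ρ j : ℝ) + 1) + 1 / ((q : ℝ) - ρ j)) :=
        Finset.sum_le_sum hterm
    _ = ∑ r ∈ (Finset.range q).image ρ, 4 * N * (1 / ((r : ℝ) + 1) + 1 / ((q : ℝ) - r)) := by
        rw [Finset.sum_image hinj]
    _ ≤ ∑ r ∈ Finset.range q, 4 * N * (1 / ((r : ℝ) + 1) + 1 / ((q : ℝ) - r)) := by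
        refine Finset.sum_le_sum_of_subset_of_nonneg ?_ fun r hr _ => hnn r hr
        exact Finset.image_subset_iff.2 fun j _ => Finset.mem_range.2 (hρlt j)
    _ = _ := by
        have : ∑ r ∈ Finset.range q, 1 / ((q : ℝ) - r) =
            ∑ r ∈ Finset.range q, 1 / ((r : ℝ) + 1) := by
          rw [← Finset.sum_range_reflect]
          refine Finset.sum_congr rfl fun r hr => ?_
          have := Finset.mem_range.1 hr
          rw [show q - 1 - r = q - (r + 1) by omega, Nat.cast_sub (by omega)]
          push_cast
          ring_nf
        rw [← Finset.mul_sum, Finset.sum_add_distrib, this]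
        ring

theorem sum_cutoff_range_le {α : ℝ} {a : ℤ} {q N : ℕ} (hq : 1 ≤ q) (hqN : q ≤ N)
    (hcop : Int.gcd a q = 1) (hα : |α - a / q| ≤ 1 / (q : ℝ) ^ 2) (M : ℕ) :
    ∑ m ∈ Finset.range M, cutoff N (α * m) ≤
      ((M : ℝ) / q + 1) * (8 * N * ∑ r ∈ Finset.range q, 1 / ((r : ℝ) + 1)) := by
  set B : ℝ := 8 * N * ∑ r ∈ Finset.range q, 1 / ((r : ℝ) + 1) with hB
  have hB0 : 0 ≤ B := by positivity
  have hblocks : ∀ b : ℕ, ∑ m ∈ Finset.range (q * b), cutoff N (α * m) ≤ b * B := by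
    intro b
    induction b with
    | zero => simp
    | succ b ih =>
      rw [mul_add_one, Finset.sum_range_add]
      push_cast
      have := sum_cutoff_block_le hq hqN hcop hα (q * b)
      push_cast at this
      linarith
  calc _ ≤ ∑ m ∈ Finset.range (q * (M / q + 1)), cutoff N (α * m) := by
        refine Finset.sum_le_sum_of_subset_of_nonneg ?_
          fun _ _ _ => cutoff_nonneg N.cast_nonneg _
        exact Finset.range_subset_range.2 (Nat.lt_mul_div_succ M hq).le
    _ ≤ ((M / q + 1 : ℕ) : ℝ) * B := hblocks _
    _ ≤ _ := by
        push_cast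
        gcongr
        exact Nat.cast_div_le

theorem sum_sum_two_mul_mul_le {f : ℕ → ℝ} (hf : ∀ m, 0 ≤ f m) {H N : ℕ} {D : ℝ}
    (hD0 : 0 ≤ D) (hD : ∀ m : ℕ, m ≠ 0 → m ≤ 2 * H * N → (m.divisors.card : ℝ) ≤ D) :
    ∑ h ∈ Finset.Icc 1 H, ∑ d ∈ Finset.Icc 1 N, f (2 * h * d) ≤
      D * ∑ m ∈ Finset.range (2 * H * N + 1), f m := by
  classical
  rw [← Finset.sum_product', ← Finset.sum_fiberwise_of_maps_to
    (t := Finset.range (2 * H * N + 1)) (g := fun p : ℕ × ℕ => 2 * p.1 * p.2), Finset.mul_sum]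
  · refine Finset.sum_le_sum fun m hm => ?_
    rw [Finset.sum_congr rfl (g := fun _ => f m)
      fun p hp => by rw [(Finset.mem_filter.1 hp).2], Finset.sum_const, nsmul_eq_mul]
    rcases Finset.eq_empty_or_nonempty ((Finset.Icc 1 H ×ˢ Finset.Icc 1 N).filter
      fun p : ℕ × ℕ => 2 * p.1 * p.2 = m) with he | ⟨p₀, hp₀⟩
    · rw [he, Finset.card_empty, Nat.cast_zero, zero_mul]
      exact mul_nonneg hD0 (hf m)
    · have hm0 : m ≠ 0 := by
        simp only [Finset.mem_filter, Finset.mem_product, Finset.mem_Icc] at hp₀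
        rw [← hp₀.2]
        have := hp₀.1.1.1
        have := hp₀.1.2.1
        positivity
      gcongr
      · exact hf m
      refine le_trans ?_ (hD m hm0 (Nat.lt_succ_iff.1 (Finset.mem_range.1 hm)))
      rw [Nat.cast_le]
      refine Finset.card_le_card_of_injOn Prod.fst ?_ ?_
      · intro p hp
        simp only [Finset.coe_filter, Set.mem_ofPred_eq] at hp
        simp only [Finset.mem_coe, Nat.mem_divisors]
        exact ⟨⟨2 * p.2, by rw [← hp.2]; ring⟩, hm0⟩
      · intro p hp p' hp' hpp
        simp only [Finset.coe_filter, Set.mem_ofPred_eq, Finset.mem_product,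
          Finset.mem_Icc] at hp hp'
        refine Prod.ext hpp ((Nat.mul_right_inj (a := 2 * p.1) ?_).1 ?_)
        · have := hp.1.1.1
          positivity
        · rw [hp.2, hpp, hp'.2]
  · intro p hp
    simp only [Finset.mem_product, Finset.mem_Icc] at hp
    rw [Finset.mem_range, Nat.lt_succ_iff]
    exact Nat.mul_le_mul (Nat.mul_le_mul_left 2 hp.1.2) hp.2.2

theorem norm_sq_sum_expTwoPi_sq_le (N h : ℕ) (α : ℝ) :
    ‖∑ n ∈ Finset.Icc 1 N, expTwoPi (h * (α * (n : ℝ) ^ 2))‖ ^ 2 ≤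
      N + 4 * ∑ d ∈ Finset.Icc 1 N, cutoff N (α * ((2 * h * d : ℕ) : ℝ)) := by
  rw [sum_Icc_one_eq_sum_range, sum_Icc_one_eq_sum_range]
  rcases N with _ | n
  · simp
  rw [normSq_sum_range_succ]
  simp only [norm_expTwoPi, one_pow, Finset.sum_const, Finset.card_range, nsmul_eq_mul, mul_one]
  have key : ∀ d ∈ Finset.range n,
      ‖∑ k ∈ Finset.range (n - d), expTwoPi (h * (α * ((k + d + 1 + 1 : ℕ) : ℝ) ^ 2)) *
        (starRingEnd ℂ) (expTwoPi (h * (α * ((k + 1 : ℕ) : ℝ) ^ 2)))‖ ≤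
      2 * cutoff (n + 1 : ℕ) (α * ((2 * h * (d + 1) : ℕ) : ℝ)) := by
    intro d _
    have : ∀ k : ℕ, expTwoPi (h * (α * ((k + d + 1 + 1 : ℕ) : ℝ) ^ 2)) *
        (starRingEnd ℂ) (expTwoPi (h * (α * ((k + 1 : ℕ) : ℝ) ^ 2))) =
        expTwoPi (h * α * (d + 1) * (d + 3)) *
          expTwoPi (α * ((2 * h * (d + 1) : ℕ) : ℝ)) ^ k := by
      intro k
      rw [expTwoPi_mul_conj, ← expTwoPi_natCast_mul, ← expTwoPi_add]
      congr 1
      push_cast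
      ring
    rw [Finset.sum_congr rfl fun k _ => this k, ← Finset.mul_sum, norm_mul, norm_expTwoPi, one_mul]
    exact norm_geom_sum_expTwoPi_le (by omega) _
  have hsum : (∑ d ∈ Finset.range n, ∑ k ∈ Finset.range (n - d),
      expTwoPi (h * (α * ((k + d + 1 + 1 : ℕ) : ℝ) ^ 2)) *
        (starRingEnd ℂ) (expTwoPi (h * (α * ((k + 1 : ℕ) : ℝ) ^ 2)))).re ≤
      2 * ∑ d ∈ Finset.range (n + 1), cutoff (n + 1 : ℕ) (α * ((2 * h * (d + 1) : ℕ) : ℝ)) := by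
    refine (Complex.re_le_norm _).trans ((norm_sum_le_of_le _ key).trans ?_)
    rw [← Finset.mul_sum, Finset.sum_range_succ]
    have := cutoff_nonneg (n + 1).cast_nonneg (α * ((2 * h * (n + 1) : ℕ) : ℝ))
    linarith
  linarith

theorem sum_norm_sq_geom_sum_le (N K : ℕ) (x : ℕ → ℝ) :
    ∑ n ∈ Finset.Icc 1 N, ‖∑ k ∈ Finset.range K, expTwoPi (x n) ^ k‖ ^ 2 ≤
      K * (N + 2 * ∑ h ∈ Finset.Icc 1 K, ‖∑ n ∈ Finset.Icc 1 N, expTwoPi (h * x n)‖) := by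
  rcases K with _ | K
  · simp
  have h1 : ∀ n, ‖∑ k ∈ Finset.range (K + 1), expTwoPi (x n) ^ k‖ ^ 2 = (K + 1) + 2 *
      (∑ d ∈ Finset.range K, ((K - d : ℕ) : ℂ) * expTwoPi (((d + 1 : ℕ) : ℝ) * x n)).re := by
    intro n
    rw [normSq_sum_range_succ]
    congr 1
    · simp [norm_expTwoPi]
    · congr 2
      refine Finset.sum_congr rfl fun d _ => ?_
      rw [Finset.sum_congr rfl (g := fun _ => expTwoPi (((d + 1 : ℕ) : ℝ) * x n))]
      · simp
      · intro k _
        rw [← expTwoPi_natCast_mul, ← expTwoPi_natCast_mul, expTwoPi_mul_conj]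
        congr 1
        push_cast
        ring
  simp only [h1]
  rw [Finset.sum_add_distrib, ← Finset.mul_sum, ← Complex.re_sum, Finset.sum_comm,
    sum_Icc_one_eq_sum_range _ (K + 1)]
  have h2 : (∑ d ∈ Finset.range K, ∑ n ∈ Finset.Icc 1 N,
      ((K - d : ℕ) : ℂ) * expTwoPi (((d + 1 : ℕ) : ℝ) * x n)).re ≤
      (K + 1) * ∑ d ∈ Finset.range (K + 1),
        ‖∑ n ∈ Finset.Icc 1 N, expTwoPi (((d + 1 : ℕ) : ℝ) * x n)‖ := by
    refine (Complex.re_le_norm _).trans ((norm_sum_le _ _).trans ?_)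
    rw [Finset.sum_range_succ, mul_add, Finset.mul_sum]
    refine le_add_of_le_of_nonneg (Finset.sum_le_sum fun d _ => ?_) (by positivity)
    rw [← Finset.mul_sum, norm_mul, Complex.norm_natCast]
    gcongr
    exact_mod_cast (Nat.sub_le K d).trans K.le_succ
  simp only [Finset.sum_const, Nat.card_Icc, nsmul_eq_mul, add_tsub_cancel_right]
  push_cast at h2 ⊢
  linarith

theorem sum_one_div_one_add_nint_sq_le {α : ℝ} {a : ℤ} {q N H : ℕ} {D : ℝ} (hH : 1 ≤ H)
    (hHq : H ^ 2 ≤ q) (hqN : q ≤ N) (hcop : Int.gcd a q = 1)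
    (hα : |α - a / q| ≤ 1 / (q : ℝ) ^ 2) (hD1 : 1 ≤ D)
    (hD : ∀ m : ℕ, m ≠ 0 → m ≤ 2 * H * N → (m.divisors.card : ℝ) ≤ D) (θ : ℝ) :
    ∑ n ∈ Finset.Icc 1 N, 1 / (1 + H * nint (α * (n : ℝ) ^ 2 + θ)) ≤
      1600 * D * (∑ r ∈ Finset.range q, 1 / ((r : ℝ) + 1)) ^ 2 * (N / H) := by
  have hq : 1 ≤ q := (Nat.one_le_pow 2 H hH).trans hHq
  set L : ℝ := ∑ r ∈ Finset.range q, 1 / ((r : ℝ) + 1) with hL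
  have hHr : (1 : ℝ) ≤ H := by exact_mod_cast hH
  have hqr : (1 : ℝ) ≤ q := by exact_mod_cast hq
  have hqNr : (q : ℝ) ≤ N := by exact_mod_cast hqN
  have hHqr : (H : ℝ) ^ 2 ≤ q := by exact_mod_cast hHq
  have hNr : (1 : ℝ) ≤ N := hqr.trans hqNr
  have hL1 : 1 ≤ L := by
    calc (1 : ℝ) = ∑ r ∈ Finset.range 1, 1 / ((r : ℝ) + 1) := by simp
      _ ≤ L := Finset.sum_le_sum_of_subset_of_nonneg (Finset.range_subset_range.2 hq)
          fun _ _ _ => by positivity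
  have hDL : 1 ≤ D * L := one_le_mul_of_one_le_of_one_le hD1 hL1
  have hHL : ∑ K ∈ Finset.Icc 1 H, 1 / (K : ℝ) ≤ L := by
    rw [sum_Icc_one_eq_sum_range]
    push_cast
    exact Finset.sum_le_sum_of_subset_of_nonneg
      (Finset.range_subset_range.2 ((Nat.le_self_pow two_ne_zero H).trans hHq))
      fun _ _ _ => by positivity
  set S : ℕ → ℝ := fun h => ‖∑ n ∈ Finset.Icc 1 N, expTwoPi (h * (α * (n : ℝ) ^ 2))‖ with hS
  have hS0 : ∀ h, 0 ≤ S h := fun h => norm_nonneg _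
  have hSsq : ∑ h ∈ Finset.Icc 1 H, S h ^ 2 ≤ 129 * (D * L) * (H * (N ^ 2 / q)) := by
    calc ∑ h ∈ Finset.Icc 1 H, S h ^ 2
        ≤ ∑ h ∈ Finset.Icc 1 H,
          (N + 4 * ∑ d ∈ Finset.Icc 1 N, cutoff N (α * ((2 * h * d : ℕ) : ℝ))) :=
          Finset.sum_le_sum fun h _ => norm_sq_sum_expTwoPi_sq_le N h α
      _ = H * N + 4 * ∑ h ∈ Finset.Icc 1 H, ∑ d ∈ Finset.Icc 1 N,
          cutoff N (α * ((2 * h * d : ℕ) : ℝ)) := by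
          rw [Finset.sum_add_distrib, ← Finset.mul_sum]
          simp
      _ ≤ H * N + 4 * (D * ((((2 * H * N + 1 : ℕ) : ℝ) / q + 1) * (8 * N * L))) := by
          have h1 := sum_sum_two_mul_mul_le (f := fun m => cutoff N (α * m))
            (fun _ => cutoff_nonneg N.cast_nonneg _) (zero_le_one.trans hD1) hD
          have h2 := sum_cutoff_range_le hq hqN hcop hα (2 * H * N + 1)
          have h3 := mul_le_mul_of_nonneg_left h2 (zero_le_one.trans hD1)
          linarith
      _ ≤ (D * L) * (H * (N ^ 2 / q)) + 4 * (D * ((4 * (H * N / q)) * (8 * N * L))) := by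
          have hNq : (1 : ℝ) ≤ N / q := by rwa [one_le_div (by linarith)]
          have h4 : (H * N : ℝ) ≤ H * (N ^ 2 / q) := by
            rw [sq, mul_div_assoc]
            gcongr
            exact le_mul_of_one_le_right (by linarith) hNq
          have h5 : ((2 * H * N + 1 : ℕ) : ℝ) / q + 1 ≤ 4 * (H * N / q) := by
            have h6 : (1 : ℝ) ≤ H * N := one_le_mul_of_one_le_of_one_le hHr hNr
            have h7 : (1 : ℝ) ≤ H * N / q := by
              rw [mul_div_assoc]; exact one_le_mul_of_one_le_of_one_le hHr hNq
            have h8 : (1 : ℝ) / q ≤ H * N / q := by gcongr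
            push_cast
            rw [add_div, show (2 * H * N / q : ℝ) = 2 * (H * N / q) by ring]
            linarith
          have h9 : (H * (N ^ 2 / q) : ℝ) ≤ D * L * (H * (N ^ 2 / q)) :=
            le_mul_of_one_le_left (by positivity) hDL
          refine add_le_add (h4.trans h9) ?_
          gcongr
      _ = _ := by ring
  have hSsum : ∑ h ∈ Finset.Icc 1 H, S h ≤ 12 * (D * L) * N := by
    refine le_of_sq_le_sq ?_ (by positivity)
    calc (∑ h ∈ Finset.Icc 1 H, S h) ^ 2 ≤ H * ∑ h ∈ Finset.Icc 1 H, S h ^ 2 := by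
          simpa using sq_sum_le_card_mul_sum_sq (s := Finset.Icc 1 H) (f := S)
      _ ≤ H * (129 * (D * L) * (H * (N ^ 2 / q))) := by gcongr
      _ = 129 * (D * L) * N ^ 2 * (H ^ 2 / q) := by ring
      _ ≤ 129 * (D * L) * N ^ 2 * 1 := by
          gcongr
          exact div_le_one_of_le₀ hHqr (by linarith)
      _ ≤ 144 * (D * L) ^ 2 * N ^ 2 * 1 := by
          gcongr
          · norm_num
          · exact le_self_pow₀ hDL two_ne_zero
      _ = _ := by ring
  have hshift : ∀ h : ℕ,
      ‖∑ n ∈ Finset.Icc 1 N, expTwoPi (h * (α * (n : ℝ) ^ 2 + θ))‖ = S h := by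
    intro h
    simp only [mul_add, expTwoPi_add]
    rw [← Finset.sum_mul, norm_mul, norm_expTwoPi, mul_one]
  have hfejer : ∀ K ∈ Finset.Icc 1 H, ∑ n ∈ Finset.Icc 1 N,
      ‖∑ k ∈ Finset.range K, expTwoPi (α * (n : ℝ) ^ 2 + θ) ^ k‖ ^ 2 / (K : ℝ) ^ 2 ≤
      25 * (D * L) * N * (1 / K) := by
    intro K hK
    obtain ⟨hK1, hKH⟩ := Finset.mem_Icc.1 hK
    have hK0 : (0 : ℝ) < K := by exact_mod_cast hK1
    have h1 := sum_norm_sq_geom_sum_le N K fun n => α * (n : ℝ) ^ 2 + θ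
    simp only [hshift] at h1
    have h2 : ∑ h ∈ Finset.Icc 1 K, S h ≤ ∑ h ∈ Finset.Icc 1 H, S h :=
      Finset.sum_le_sum_of_subset_of_nonneg (Finset.Icc_subset_Icc_right hKH) fun _ _ _ => hS0 _
    have h3 : (N : ℝ) ≤ D * L * N := le_mul_of_one_le_left (by linarith) hDL
    rw [← Finset.sum_div, div_le_iff₀ (by positivity)]
    calc _ ≤ _ := h1
      _ ≤ K * (25 * (D * L) * N) := by gcongr; linarith
      _ = _ := by field_simp
  calc _ ≤ ∑ n ∈ Finset.Icc 1 N, 64 / H * ∑ K ∈ Finset.Icc 1 H,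
        ‖∑ k ∈ Finset.range K, expTwoPi (α * (n : ℝ) ^ 2 + θ) ^ k‖ ^ 2 / (K : ℝ) ^ 2 :=
        Finset.sum_le_sum fun n _ => one_div_one_add_le_fejer hH _
    _ = 64 / H * ∑ K ∈ Finset.Icc 1 H, ∑ n ∈ Finset.Icc 1 N,
        ‖∑ k ∈ Finset.range K, expTwoPi (α * (n : ℝ) ^ 2 + θ) ^ k‖ ^ 2 / (K : ℝ) ^ 2 := by
        rw [← Finset.mul_sum, Finset.sum_comm]
    _ ≤ 64 / H * ∑ K ∈ Finset.Icc 1 H, 25 * (D * L) * N * (1 / K) := by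
        gcongr with K hK
        exact hfejer K hK
    _ ≤ 64 / H * (25 * (D * L) * N * L) := by
        rw [← Finset.mul_sum]
        gcongr
    _ = _ := by ring

theorem ite_nint_le_two_div (H x : ℝ) (hH : 0 < H) :
    (if nint x = 0 then (1 : ℝ) else min 1 (1 / (H * nint x))) ≤ 2 * (1 / (1 + H * nint x)) := by
  split_ifs with h
  · rw [h]; norm_num
  · have ht : 0 < nint x := (nint_nonneg x).lt_of_ne' h
    have hHt : 0 < H * nint x := by positivity
    rw [mul_one_div]
    rcases le_total (H * nint x) 1 with h1 | h1
    · refine (min_le_left _ _).trans ?_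
      rw [le_div_iff₀ (by positivity)]
      linarith
    · refine (min_le_right _ _).trans ?_
      rw [div_le_div_iff₀ hHt (by positivity)]
      linarith

theorem sum_range_one_div_le {q : ℕ} (hq : 1 ≤ q) {X η : ℝ} (hη : 0 < η) (hqX : (q : ℝ) ≤ X) :
    ∑ r ∈ Finset.range q, 1 / ((r : ℝ) + 1) ≤ (1 + 1 / η) * X ^ η := by
  have hq1 : (1 : ℝ) ≤ q := by exact_mod_cast hq
  have h1 : ∑ r ∈ Finset.range q, 1 / ((r : ℝ) + 1) = (harmonic q : ℝ) := by
    simp [harmonic]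
  have h2 := Real.log_le_rpow_div (x := X) (by linarith) hη
  have h3 : Real.log q ≤ Real.log X := Real.log_le_log (by linarith) hqX
  have h4 : 1 ≤ X ^ η := Real.one_le_rpow (hq1.trans hqX) hη.le
  calc _ ≤ 1 + Real.log q := by rw [h1]; exact harmonic_le_one_add_log q
    _ ≤ X ^ η + X ^ η / η := by linarith
    _ = _ := by ring

theorem Omega_bound (γ ε : ℝ) (hγ1 : 13 / 14 < γ) (hγ2 : γ < 1) (hε : 0 < ε) :
    ∃ C > 0, ∀ (α β Δ : ℝ) (a : ℤ) (q : ℕ),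
      2 ≤ q → Int.gcd a (q : ℤ) = 1 → |α - (a : ℝ) / (q : ℝ)| < 1 / (q : ℝ) ^ 2 →
      ∑ n ∈ Finset.Icc 1 ⌊(q : ℝ) ^ (29 / (55 - 28 * γ))⌋₊,
        ((if nint (α * (n : ℝ) ^ 2 + β + Δ) = 0 then (1 : ℝ)
          else min 1 (1 / ((⌊Real.sqrt q⌋₊ : ℝ) * nint (α * (n : ℝ) ^ 2 + β + Δ)))) +
         (if nint (α * (n : ℝ) ^ 2 + β - Δ) = 0 then (1 : ℝ)
          else min 1 (1 / ((⌊Real.sqrt q⌋₊ : ℝ) * nint (α * (n : ℝ) ^ 2 + β - Δ))))) ≤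
      C * ((q : ℝ) ^ (29 / (55 - 28 * γ))) ^ ((28 * γ + 3) / 58 + ε) := by
  set η : ℝ := ε / 4 with hη_def
  have hη : 0 < η := by positivity
  obtain ⟨C, hC1, hC⟩ := exists_card_divisors_le_rpow hη
  refine ⟨12800 * (C * 2 ^ η) * (1 + 1 / η) ^ 2, by positivity, ?_⟩
  intro α β Δ a q hq hcop hα
  have hq1 : (1 : ℝ) ≤ q := by exact_mod_cast (by omega : 1 ≤ q)
  set κ : ℝ := 29 / (55 - 28 * γ) with hκ
  have hden : 0 < 55 - 28 * γ := by linarith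
  have hκ1 : 1 ≤ κ := by rw [hκ, one_le_div hden]; linarith
  set X : ℝ := (q : ℝ) ^ κ with hX
  have hqX : (q : ℝ) ≤ X := Real.self_le_rpow_of_one_le hq1 hκ1
  have hX1 : 1 ≤ X := hq1.trans hqX
  have hX0 : 0 < X := by linarith
  set N : ℕ := ⌊X⌋₊ with hN
  have hqN : q ≤ N := Nat.le_floor hqX
  have hNX : (N : ℝ) ≤ X := Nat.floor_le hX0.le
  set H : ℕ := ⌊Real.sqrt q⌋₊ with hH
  have hsqrt1 : 1 ≤ Real.sqrt q := Real.one_le_sqrt.2 hq1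
  have hH1 : 1 ≤ H := Nat.le_floor (by exact_mod_cast hsqrt1)
  have hH1r : (1 : ℝ) ≤ H := by exact_mod_cast hH1
  have hHs : (H : ℝ) ≤ Real.sqrt q := Nat.floor_le (Real.sqrt_nonneg _)
  have hHq : H ^ 2 ≤ q := by
    have : (H : ℝ) ^ 2 ≤ q := by
      calc (H : ℝ) ^ 2 ≤ Real.sqrt q ^ 2 := by gcongr
        _ = (q : ℝ) := Real.sq_sqrt (by linarith)
    exact_mod_cast this
  have hHlow : Real.sqrt q ≤ 2 * H := by
    have := Nat.lt_floor_add_one (Real.sqrt q)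
    linarith
  have hHX : (H : ℝ) ≤ X := by
    have : H ≤ q := (Nat.le_self_pow two_ne_zero H).trans hHq
    exact (Nat.cast_le.2 this).trans hqX
  set D : ℝ := C * 2 ^ η * X ^ (2 * η) with hD
  have hDeq : D = C * (2 * X ^ (2 : ℕ)) ^ η := by
    rw [hD, Real.mul_rpow (by norm_num) (by positivity), ← Real.rpow_natCast, ← Real.rpow_mul hX0.le,
      mul_assoc]
    norm_num
  have hD1 : 1 ≤ D := by
    rw [hDeq]
    refine one_le_mul_of_one_le_of_one_le hC1 (Real.one_le_rpow ?_ hη.le)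
    nlinarith
  have hDdiv : ∀ m : ℕ, m ≠ 0 → m ≤ 2 * H * N → (m.divisors.card : ℝ) ≤ D := by
    intro m hm0 hm
    have hmX : (m : ℝ) ≤ 2 * X ^ 2 := by
      calc (m : ℝ) ≤ 2 * H * N := by exact_mod_cast hm
        _ ≤ 2 * X * X := by gcongr
        _ = _ := by ring
    rw [hDeq]
    refine (hC m hm0).trans ?_
    gcongr
  set L : ℝ := ∑ r ∈ Finset.range q, 1 / ((r : ℝ) + 1)
  have hL0 : 0 ≤ L := Finset.sum_nonneg fun _ _ => by positivity
  have hL : L ≤ (1 + 1 / η) * X ^ η := sum_range_one_div_le (by omega) hη hqX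
  have hmain := sum_one_div_one_add_nint_sq_le hH1 hHq hqN hcop hα.le hD1 hDdiv
  have hNH : (N : ℝ) / H ≤ 2 * X ^ ((28 * γ + 3) / 58) := by
    have hs : Real.sqrt q = X ^ ((55 - 28 * γ) / 58) := by
      rw [Real.sqrt_eq_rpow, hX, ← Real.rpow_mul (by linarith)]
      congr 1
      rw [hκ]
      field_simp
      norm_num
    have hX' : X = X ^ ((28 * γ + 3) / 58) * Real.sqrt q := by
      rw [hs, ← Real.rpow_add hX0]
      conv_lhs => rw [← Real.rpow_one X]
      congr 1
      ring
    rw [div_le_iff₀ (by linarith)]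
    calc (N : ℝ) ≤ X ^ ((28 * γ + 3) / 58) * Real.sqrt q := hNX.trans hX'.le
      _ ≤ X ^ ((28 * γ + 3) / 58) * (2 * H) := by gcongr
      _ = _ := by ring
  calc _ ≤ ∑ n ∈ Finset.Icc 1 N, (2 * (1 / (1 + H * nint (α * (n : ℝ) ^ 2 + (β + Δ)))) +
        2 * (1 / (1 + H * nint (α * (n : ℝ) ^ 2 + (β - Δ))))) := by
        refine Finset.sum_le_sum fun n _ => ?_
        rw [← add_assoc, ← add_sub_assoc]
        exact add_le_add (ite_nint_le_two_div _ _ (by linarith))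
          (ite_nint_le_two_div _ _ (by linarith))
    _ ≤ 6400 * D * L ^ 2 * (N / H) := by
        rw [Finset.sum_add_distrib, ← Finset.mul_sum, ← Finset.mul_sum]
        linarith [hmain (β + Δ), hmain (β - Δ)]
    _ ≤ 6400 * D * ((1 + 1 / η) * X ^ η) ^ 2 * (2 * X ^ ((28 * γ + 3) / 58)) := by gcongr
    _ = 12800 * (C * 2 ^ η) * (1 + 1 / η) ^ 2 *
        (X ^ ((28 * γ + 3) / 58) * (X ^ (2 * η) * (X ^ η) ^ 2)) := by rw [hD]; ring
    _ = _ := by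
        congr 1
        rw [← Real.rpow_natCast, ← Real.rpow_mul hX0.le, ← Real.rpow_add hX0, ← Real.rpow_add hX0]
        congr 1
        push_cast
        rw [hη_def]
        ring
end

section
/- Suppose α is irrational, a, q are integers with q ≥ 2, gcd(a,q) = 1, a ≠ 0 and |α − a/q| < 1/q². Let h be an integer with 1 ≤ h ≤ ⌊q^{1/2}⌋, and let a_h, q_h be integers with gcd(a_h, q_h) = 1, 1 ≤ q_h ≤ q² and |αh − a_h/q_h| ≤ 1/(q_h q²). Then, for q sufficiently large, q_h > q^{1/3}. -/
/-- Two fractions close to `α` and `α * h` with small denominators must satisfy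
`a / q * h = b / r`, stated after clearing denominators. -/
lemma mul_eq_mul_of_abs_sub_div_lt {α : ℝ} {a b : ℤ} {q h r : ℕ} (hq : 0 < q) (hh : 0 < h)
    (hr : 0 < r) (hα : |α - (a : ℝ) / q| < 1 / (q : ℝ) ^ 2)
    (hαh : |α * h - (b : ℝ) / r| ≤ 1 / ((r : ℝ) * (q : ℝ) ^ 2)) (hlt : h * r < q) :
    a * (h * r : ℕ) = b * q := by
  have hq' : (0 : ℝ) < q := by exact_mod_cast hq
  have hh' : (0 : ℝ) < h := by exact_mod_cast hh
  have hr' : (0 : ℝ) < r := by exact_mod_cast hr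
  have hlt' : (h : ℝ) * r + 1 ≤ q := by exact_mod_cast hlt
  rw [lt_div_iff₀ (by positivity)] at hα
  rw [le_div_iff₀ (by positivity)] at hαh
  have key : (q : ℝ) * ((a : ℝ) * (h * r) - b * q) =
      (r * q ^ 2) * (α * h - b / r) - (h * r) * (q ^ 2 * (α - a / q)) := by
    field_simp
    ring
  have hbound : (q : ℝ) * |(a : ℝ) * (h * r) - b * q| < q * 1 := by
    calc (q : ℝ) * |(a : ℝ) * (h * r) - b * q|
        = |(q : ℝ) * ((a : ℝ) * (h * r) - b * q)| := by rw [abs_mul, abs_of_pos hq']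
      _ ≤ |((r : ℝ) * q ^ 2) * (α * h - b / r)| + |((h : ℝ) * r) * (q ^ 2 * (α - a / q))| := by
          rw [key]
          exact abs_sub _ _
      _ = |α * h - b / r| * (r * q ^ 2) + (h * r) * (|α - a / q| * q ^ 2) := by
          simp only [abs_mul, abs_pow, Nat.abs_cast]
          ring
      _ < 1 + (h * r) * 1 :=
          add_lt_add_of_le_of_lt hαh (mul_lt_mul_of_pos_left hα (by positivity))
      _ ≤ q * 1 := by linarith
  have habs : |a * (h * r : ℕ) - b * q| < 1 := by
    exact_mod_cast lt_of_mul_lt_mul_left hbound hq'.le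
  exact sub_eq_zero.mp (Int.abs_lt_one_iff.mp habs)

theorem qh_lower_bound :
    ∃ q₀ : ℕ, ∀ (α : ℝ) (a : ℤ) (q : ℕ) (h : ℕ) (a_h : ℤ) (q_h : ℕ),
      Irrational α → q₀ ≤ q → 2 ≤ q → Int.gcd a (q : ℤ) = 1 → a ≠ 0 →
      |α - (a : ℝ) / (q : ℝ)| < 1 / (q : ℝ) ^ 2 →
      1 ≤ h → (h : ℝ) ≤ Real.sqrt q →
      Int.gcd a_h (q_h : ℤ) = 1 → 1 ≤ q_h → q_h ≤ q ^ 2 →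
      |α * (h : ℝ) - (a_h : ℝ) / (q_h : ℝ)| ≤ 1 / ((q_h : ℝ) * (q : ℝ) ^ 2) →
      (q : ℝ) ^ ((1 : ℝ) / 3) < (q_h : ℝ) := by
  refine ⟨0, fun α a q h a_h q_h _ _ hq hgcd _ hα hh hhq _ hqh _ hαh ↦ ?_⟩
  by_contra! hle
  have hq' : (1 : ℝ) < q := by exact_mod_cast hq
  have hlt : h * q_h < q := by
    have : (h : ℝ) * q_h < q := by
      calc (h : ℝ) * q_h ≤ (q : ℝ) ^ ((1 : ℝ) / 2) * (q : ℝ) ^ ((1 : ℝ) / 3) := by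
            rw [← Real.sqrt_eq_rpow]
            gcongr
        _ = (q : ℝ) ^ ((1 : ℝ) / 2 + 1 / 3) := (Real.rpow_add (by linarith) _ _).symm
        _ < (q : ℝ) ^ (1 : ℝ) := Real.rpow_lt_rpow_of_exponent_lt hq' (by norm_num)
        _ = q := Real.rpow_one _
    exact_mod_cast this
  have heq := mul_eq_mul_of_abs_sub_div_lt (by omega) hh hqh hα hαh hlt
  have hdvd : (q : ℤ) ∣ (h * q_h : ℕ) :=
    Int.dvd_of_dvd_mul_right_of_gcd_one (Dvd.intro_left a_h heq.symm) (by rwa [Int.gcd_comm])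
  exact (Nat.le_of_dvd (Nat.mul_pos hh hqh) (Int.natCast_dvd_natCast.mp hdvd)).not_gt hlt
end
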